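/- arXiv:math/0405341 — 4 statements merged into one kernel-verified Lean document; each statement's English description precedes it below -/
import Mathlib

section
/- Let m ≥ 1, let g_1 ≥ g_2 ≥ … ≥ g_m > 0 be real numbers and let p_1, …, p_m > 0 satisfy p_1 + … + p_m = 1. Then for every L ≥ 1.12 there exist real numbers k_j^i (for 1 ≤ j < i ≤ m) such that: (i) k_j^i ≥ 0 for all j < i; (ii) Σ_{j<i} k_j^i p_j ≤ 1 for every i ≤ m; and (iii) Σ_{i≤m} (p_i/g_i) · exp( Σ_{j<i} ( log(g_i/g_j) · k_j^i + (1/L)·ψ(k_j^i) ) · p_j ) ≤ 1/(p_1 g_1 + … + p_m g_m). -/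
open Finset

/-- The function ψ from Talagrand's kernel lemma: ψ(x) = x²/4 for x ≤ 2, x − 1 for x ≥ 2. -/
noncomputable def psi (x : ℝ) : ℝ := if x ≤ 2 then x ^ 2 / 4 else x - 1

theorem exp_sub_one_le_mul_add_sq {L u : ℝ} (hL : 1.12 ≤ L) (hu : 0 ≤ u) (huL : u ≤ 1 / L) :
    Real.exp u - 1 ≤ L * u + L * u ^ 2 / 2 := by
  have hLpos : 0 < L := by linarith
  have hu' : u ≤ 25 / 28 := by
    refine huL.trans ?_
    rw [div_le_div_iff₀ hLpos (by norm_num)]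
    linarith
  have h := Real.exp_bound' hu (by linarith) (n := 5) (by norm_num)
  norm_num [Finset.sum_range_succ, Nat.factorial] at h
  have h2 : u ^ 2 ≤ (25 / 28) * u := by nlinarith
  have h3 : u ^ 3 ≤ (25 / 28) ^ 2 * u := by nlinarith
  have h4 : u ^ 4 ≤ (25 / 28) * u ^ 3 := by nlinarith [pow_nonneg hu 3]
  have h5 : u ^ 5 ≤ (25 / 28) ^ 2 * u ^ 3 := by nlinarith [pow_nonneg hu 4, pow_nonneg hu 3]
  have h3' : u ^ 3 ≤ (25 / 28) * u ^ 2 := by nlinarith [pow_nonneg hu 2]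
  nlinarith [mul_nonneg hu hu]

/-- The exponential moment estimate behind the kernel lemma. -/
theorem sq_sum_exp_mul_one_sub_le {ι : Type*} [Fintype ι] {p u : ι → ℝ} {L : ℝ}
    (hL : 1.12 ≤ L) (hp : ∀ i, 0 < p i) (hsum : ∑ i, p i = 1)
    (hu : ∀ i, 0 ≤ u i) (huL : ∀ i, u i ≤ 1 / L) :
    (∑ i, p i * Real.exp (u i)) ^ 2 * (1 - 2 * L * ∑ i, p i * u i) ≤
      Real.exp (L * ∑ i, p i * u i ^ 2) := by
  have h1 : ∑ i, p i * Real.exp (u i) ≤ Real.exp (∑ i, p i * (Real.exp (u i) - 1)) := by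
    have := Real.add_one_le_exp (∑ i, p i * (Real.exp (u i) - 1))
    simp only [mul_sub, Finset.sum_sub_distrib, mul_one, hsum] at this ⊢
    linarith
  have h0 : 0 ≤ ∑ i, p i * Real.exp (u i) :=
    Finset.sum_nonneg fun i _ => mul_nonneg (hp i).le (Real.exp_pos _).le
  have h2 : 1 - 2 * L * ∑ i, p i * u i ≤ Real.exp (-(2 * L * ∑ i, p i * u i)) := by
    have := Real.add_one_le_exp (-(2 * L * ∑ i, p i * u i))
    linarith
  calc _ ≤ (∑ i, p i * Real.exp (u i)) ^ 2 * Real.exp (-(2 * L * ∑ i, p i * u i)) := by gcongr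
    _ ≤ Real.exp (∑ i, p i * (Real.exp (u i) - 1)) ^ 2 *
          Real.exp (-(2 * L * ∑ i, p i * u i)) := by gcongr
    _ = Real.exp (∑ i, p i * (2 * (Real.exp (u i) - 1) - 2 * L * u i)) := by
        rw [← Real.exp_nat_mul, ← Real.exp_add]
        congr 1
        simp only [Finset.mul_sum, ← Finset.sum_neg_distrib, ← Finset.sum_add_distrib]
        refine Finset.sum_congr rfl fun i _ => ?_
        push_cast
        ring
    _ ≤ _ := by
        rw [Real.exp_le_exp, Finset.mul_sum]
        refine Finset.sum_le_sum fun i _ => ?_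
        have := exp_sub_one_le_mul_add_sq hL (hu i) (huL i)
        nlinarith [hp i]

theorem max_right_hasDerivWithinAt (a t : ℝ) :
    HasDerivWithinAt (fun x => max a x) (if a ≤ t then 1 else 0) (Set.Ici t) t := by
  split_ifs with h
  · refine (hasDerivWithinAt_id t _).congr (fun x hx => ?_) (max_eq_right h)
    exact max_eq_right (h.trans hx)
  · push Not at h
    refine ((hasDerivAt_const t a).congr_of_eventuallyEq ?_).hasDerivWithinAt
    filter_upwards [eventually_lt_nhds h] with x hx
    exact max_eq_left hx.le

/-- The value `exp (-t - L ∑ pⱼ ((hⱼ - t)⁺)²)` attained by the quadratic kernel at level `t`. -/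
noncomputable def quadWeight {ι : Type*} [Fintype ι] (L : ℝ) (p h : ι → ℝ) (t : ℝ) : ℝ :=
  Real.exp (-t - L * ∑ j, p j * (max (h j) t - t) ^ 2)

theorem continuous_quadWeight {ι : Type*} [Fintype ι] (L : ℝ) (p h : ι → ℝ) :
    Continuous (quadWeight L p h) := by
  unfold quadWeight
  fun_prop

theorem quadWeight_hasDerivWithinAt {ι : Type*} [Fintype ι] (L : ℝ) (p h : ι → ℝ) (t : ℝ) :
    HasDerivWithinAt (quadWeight L p h)
      (-(quadWeight L p h t * (1 - 2 * L * ∑ j, p j * (max (h j) t - t)))) (Set.Ici t) t := by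
  have hS : HasDerivWithinAt (fun x => ∑ j, p j * (max (h j) x - x) ^ 2)
      (∑ j, p j * (-2 * (max (h j) t - t))) (Set.Ici t) t := by
    refine HasDerivWithinAt.fun_sum fun j _ => ?_
    have := (((max_right_hasDerivWithinAt (h j) t).sub (hasDerivWithinAt_id t _)).pow 2).const_mul
      (p j)
    refine this.congr_deriv ?_
    by_cases hj : h j ≤ t
    · simp [hj]
    · simp [hj]
  have := (((hasDerivWithinAt_id t (Set.Ici t)).neg).sub (hS.const_mul L)).exp
  refine this.congr_deriv ?_
  simp only [quadWeight, Pi.sub_apply, Pi.neg_apply, id]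
  have e : ∑ j, p j * (-2 * (max (h j) t - t)) = -2 * ∑ j, p j * (max (h j) t - t) := by
    rw [Finset.mul_sum]
    exact Finset.sum_congr rfl fun j _ => by ring
  rw [e]
  ring

theorem comp_max_hasDerivWithinAt {f : ℝ → ℝ} {f' t : ℝ}
    (hf : HasDerivWithinAt f f' (Set.Ici t) t) (a : ℝ) :
    HasDerivWithinAt (fun x => f (max a x)) (if a ≤ t then f' else 0) (Set.Ici t) t := by
  split_ifs with h
  · refine hf.congr (fun x hx => ?_) (by rw [max_eq_right h])
    rw [max_eq_right (h.trans hx)]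
  · push Not at h
    refine ((hasDerivAt_const t (f a)).congr_of_eventuallyEq ?_).hasDerivWithinAt
    filter_upwards [eventually_lt_nhds h] with x hx
    rw [max_eq_left hx.le]

theorem sum_quadWeight_le {ι : Type*} [Fintype ι] {p h : ι → ℝ} {L s b : ℝ}
    (hL : 1.12 ≤ L) (hp : ∀ i, 0 < p i) (hsum : ∑ i, p i = 1)
    (hb : ∀ i, h i ≤ b) (hsb : s ≤ b) (hbs : b - s ≤ 1 / L) :
    ∑ i, p i * quadWeight L p h (max (h i) s) ≤ 1 / ∑ i, p i * Real.exp (max (h i) s) := by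
  have hLpos : 0 < L := by linarith
  have hne : (univ : Finset ι).Nonempty := by
    rw [Finset.nonempty_iff_ne_empty]
    intro h0
    simp [h0] at hsum
  have hG : ∀ t, 0 < ∑ i, p i * Real.exp (max (h i) t) := fun t =>
    Finset.sum_pos (fun i _ => mul_pos (hp i) (Real.exp_pos _)) hne
  set D : ℝ → ℝ := fun t => (∑ i, p i * Real.exp (max (h i) t))⁻¹ -
    ∑ i, p i * quadWeight L p h (max (h i) t) with hD
  have hcont : Continuous D := by
    have := continuous_quadWeight L p h
    refine Continuous.sub (Continuous.inv₀ (by fun_prop) fun t => (hG t).ne') (by fun_prop)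
  have hDb : D b = 0 := by
    have hS : quadWeight L p h b = Real.exp (-b) := by
      simp [quadWeight, fun i => max_eq_right (hb i)]
    simp only [hD, fun i => max_eq_right (hb i), ← Finset.sum_mul, hsum, hS, one_mul,
      Real.exp_neg, sub_self]
  have hder : ∀ t, HasDerivWithinAt D
      (-(∑ i, p i * (if h i ≤ t then Real.exp t else 0)) /
          (∑ i, p i * Real.exp (max (h i) t)) ^ 2 -
        ∑ i, p i * (if h i ≤ t then
          -(quadWeight L p h t * (1 - 2 * L * ∑ j, p j * (max (h j) t - t))) else 0))
      (Set.Ici t) t := by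
    intro t
    refine HasDerivWithinAt.sub (HasDerivWithinAt.fun_inv ?_ (hG t).ne') ?_
    · exact HasDerivWithinAt.fun_sum fun i _ =>
        (comp_max_hasDerivWithinAt (Real.hasDerivAt_exp t).hasDerivWithinAt (h i)).const_mul (p i)
    · exact HasDerivWithinAt.fun_sum fun i _ =>
        (comp_max_hasDerivWithinAt (quadWeight_hasDerivWithinAt L p h t) (h i)).const_mul (p i)
  have key : D b ≤ D s := by
    refine image_le_of_deriv_right_le_deriv_boundary (f := D) (B := fun _ => D s)
      (B' := fun _ => 0) hcont.continuousOn (fun x _ => hder x) le_rfl continuousOn_const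
      (fun x _ => hasDerivWithinAt_const _ _ _) ?_ (Set.right_mem_Icc.2 hsb)
    intro t ht
    have hmom := sq_sum_exp_mul_one_sub_le (u := fun i => max (h i) t - t) hL hp hsum
      (fun i => sub_nonneg.2 (le_max_right _ _))
      (fun i => by linarith [max_le (hb i) ht.2.le, ht.1])
    have hexp : ∑ i, p i * Real.exp (max (h i) t - t) =
        (∑ i, p i * Real.exp (max (h i) t)) * Real.exp (-t) := by
      rw [Finset.sum_mul]
      exact Finset.sum_congr rfl fun i _ => by rw [sub_eq_add_neg, Real.exp_add, mul_assoc]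
    rw [hexp] at hmom
    have hGt := hG t
    set G := ∑ i, p i * Real.exp (max (h i) t)
    set K := 1 - 2 * L * ∑ j, p j * (max (h j) t - t)
    have hw : quadWeight L p h t * K ≤ Real.exp t / G ^ 2 := by
      rw [le_div_iff₀ (by positivity), quadWeight, Real.exp_sub, div_mul_eq_mul_div,
        div_mul_eq_mul_div, div_le_iff₀ (Real.exp_pos _)]
      have h1 : Real.exp (-t) * Real.exp t = 1 := by rw [← Real.exp_add]; simp
      calc Real.exp (-t) * K * G ^ 2
          = (Real.exp (-t) * Real.exp t) * (Real.exp (-t) * K * G ^ 2) := by rw [h1, one_mul]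
        _ = Real.exp t * ((G * Real.exp (-t)) ^ 2 * K) := by ring
        _ ≤ _ := by gcongr
    rw [sub_nonpos, neg_div, Finset.sum_div, ← Finset.sum_neg_distrib]
    refine Finset.sum_le_sum fun i _ => ?_
    split_ifs
    · have := mul_le_mul_of_nonneg_left hw (hp i).le
      rw [mul_neg, mul_div_assoc]
      linarith
    · simp
  rw [hDb] at key
  simp only [hD, sub_nonneg] at key
  rwa [one_div]

/-- Existence of the level below which the kernel is frozen. -/
theorem exists_saturation_level {ι : Type*} [Fintype ι] {p h : ι → ℝ} {L b : ℝ}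
    (hL : 0 < L) (hb : ∀ i, h i ≤ b) :
    ∃ s ≤ b, b - s ≤ 1 / L ∧ ∑ j, 2 * L * (max (h j) s - s) * p j ≤ 1 ∧
      (∑ j, 2 * L * (max (h j) s - s) * p j < 1 → b - s = 1 / L) := by
  set c : ℝ → ℝ := fun s => ∑ j, 2 * L * (max (h j) s - s) * p j with hc
  have hcont : Continuous c := by fun_prop
  have hle : b - 1 / L ≤ b := by linarith [one_div_pos.2 hL]
  by_cases h1 : c (b - 1 / L) ≤ 1
  · exact ⟨b - 1 / L, hle, by simp, h1, fun _ => by ring⟩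
  · have hcb : c b = 0 := by simp [hc, fun i => max_eq_right (hb i)]
    obtain ⟨s, hs, hs1⟩ := intermediate_value_Icc' hle hcont.continuousOn
      (show (1 : ℝ) ∈ Set.Icc (c b) (c (b - 1 / L)) from ⟨by rw [hcb]; norm_num, by linarith⟩)
    exact ⟨s, hs.2, by linarith [hs.1], hs1.le, fun h => absurd hs1 h.ne⟩

theorem psi_two_mul {L w : ℝ} (hL : 0 < L) (hw : w ≤ 1 / L) :
    psi (2 * L * w) = L ^ 2 * w ^ 2 := by
  have : w * L ≤ 1 := (le_div_iff₀ hL).1 hw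
  rw [psi, if_pos (by linarith)]
  ring

theorem psi_two_add {δ : ℝ} (hδ : 0 ≤ δ) : psi (2 + δ) = 1 + δ := by
  unfold psi
  split_ifs with h
  · obtain rfl : δ = 0 := by linarith
    norm_num
  · ring

theorem exists_kernel_row {m : ℕ} {p h : Fin m → ℝ} {L s b : ℝ} (hL : 0 < L)
    (hanti : Antitone h) (hp : ∀ i, 0 < p i) (o : Fin m) (ho : h o = b)
    (hb : ∀ i, h i ≤ b) (hsb : s ≤ b) (hbs : b - s ≤ 1 / L)
    (hc : ∑ j, 2 * L * (max (h j) s - s) * p j ≤ 1)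
    (hsat : ∑ j, 2 * L * (max (h j) s - s) * p j < 1 → b - s = 1 / L) (i : Fin m) :
    ∃ k : Fin m → ℝ, (∀ j, 0 ≤ k j) ∧ ∑ j ∈ univ.filter (fun j => j < i), k j * p j ≤ 1 ∧
      Real.exp (-h i) * Real.exp (∑ j ∈ univ.filter (fun j => j < i),
        ((h i - h j) * k j + (1 / L) * psi (k j)) * p j) =
      quadWeight L p h (max (h i) s) := by
  have hfilter : ∀ f : Fin m → ℝ, (∀ j, i ≤ j → f j = 0) →
      ∑ j ∈ univ.filter (fun j => j < i), f j = ∑ j, f j := by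
    intro f hf
    refine Finset.sum_subset (Finset.filter_subset _ _) fun j _ hj => hf j ?_
    simpa using hj
  have hpsi0 : psi 0 = 0 := by norm_num [psi]
  rcases le_or_gt s (h i) with hi | hi
  · have hw : ∀ j, 0 ≤ max (h j) (h i) - h i := fun j => sub_nonneg.2 (le_max_right _ _)
    have hz : ∀ j, i ≤ j → max (h j) (h i) - h i = 0 := fun j hj => by
      rw [max_eq_right (hanti hj), sub_self]
    refine ⟨fun j => 2 * L * (max (h j) (h i) - h i), fun j => by have := hw j; positivity, ?_, ?_⟩
    · rw [hfilter _ fun j hj => by simp [hz j hj]]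
      refine le_trans (Finset.sum_le_sum fun j _ => ?_) hc
      have : max (h j) (h i) - h i ≤ max (h j) s - s := by
        rcases max_cases (h j) (h i) with ⟨e, _⟩ | ⟨e, _⟩ <;> rw [e]
        · linarith [le_max_left (h j) s]
        · linarith [le_max_right (h j) s]
      have := hp j
      beta_reduce
      gcongr
    · rw [hfilter _ fun j hj => by simp [hz j hj, hpsi0], quadWeight, max_eq_left hi,
        ← Real.exp_add, sub_eq_add_neg, Finset.mul_sum, ← Finset.sum_neg_distrib]
      congr 2
      refine Finset.sum_congr rfl fun j _ => ?_
      beta_reduce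
      rw [psi_two_mul hL (by linarith [max_le (hb j) (hb i)])]
      rcases max_cases (h j) (h i) with ⟨e, _⟩ | ⟨e, _⟩ <;> simp only [e]
      · field_simp
        ring
      · simp
  · set c := ∑ j, 2 * L * (max (h j) s - s) * p j with hcdef
    have hw : ∀ j, 0 ≤ max (h j) s - s := fun j => sub_nonneg.2 (le_max_right _ _)
    have hz : ∀ j, i ≤ j → max (h j) s - s = 0 := fun j hj => by
      rw [max_eq_right ((hanti hj).trans hi.le), sub_self]
    have hzo : ∀ j, i ≤ j → j ≠ o := by
      rintro j hj rfl
      linarith [hanti hj]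
    have hδ : 0 ≤ (1 - c) / p o := div_nonneg (by linarith) (hp o).le
    set k : Fin m → ℝ := fun j => 2 * L * (max (h j) s - s) + if j = o then (1 - c) / p o else 0
      with hk
    have hk0 : ∀ j, i ≤ j → k j = 0 := fun j hj => by simp [hk, hz j hj, hzo j hj]
    have hK : ∑ j, k j * p j = 1 := by
      simp only [hk, add_mul, Finset.sum_add_distrib, ite_mul, zero_mul, Finset.sum_ite_eq',
        Finset.mem_univ, if_true]
      rw [← hcdef, div_mul_cancel₀ _ (hp o).ne']
      ring
    refine ⟨k, fun j => ?_, ?_, ?_⟩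
    · have := hw j
      simp only [hk]
      split_ifs <;> positivity
    · rw [hfilter _ fun j hj => by simp [hk0 j hj], hK]
    · rw [hfilter _ fun j hj => by simp [hk0 j hj, hpsi0], quadWeight, max_eq_right hi.le,
        ← Real.exp_add]
      have hterm : ∀ j, ((h i - h j) * k j + (1 / L) * psi (k j)) * p j =
          (h i - s) * (k j * p j) - L * (p j * (max (h j) s - s) ^ 2) := by
        intro j
        have hwL : max (h j) s - s ≤ 1 / L := by linarith [max_le (hb j) hsb]
        by_cases hj : j = o ∧ c < 1
        · have hbs' := hsat hj.2
          have hmax : max (h j) s - s = 1 / L := by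
            rw [hj.1, ho, max_eq_left hsb, hbs']
          have hkj : k j = 2 + (1 - c) / p o := by
            simp only [hk, hmax, if_pos hj.1]
            field_simp
          have hhj : h j = s + 1 / L := by rw [hj.1, ho]; linarith
          rw [hmax, hkj, psi_two_add hδ, hhj]
          field_simp
          ring
        · have hkj : k j = 2 * L * (max (h j) s - s) := by
            simp only [hk, add_eq_left, ite_eq_right_iff]
            intro hjo
            have : c = 1 := le_antisymm hc (not_lt.1 fun hlt => hj ⟨hjo, hlt⟩)
            simp [this]
          rw [hkj, psi_two_mul hL hwL]
          rcases max_cases (h j) s with ⟨e, _⟩ | ⟨e, _⟩ <;> simp only [e]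
          · field_simp
            ring
          · simp
      rw [Finset.sum_congr rfl fun j _ => hterm j, Finset.sum_sub_distrib, ← Finset.mul_sum,
        ← Finset.mul_sum, hK]
      congr 1
      ring

/-- Talagrand's kernel lemma (Lemma 1): for L ≥ 1.12 there exists an admissible kernel
`k j i` (for j < i) satisfying the key exponential inequality. -/
theorem kernel_lemma (m : ℕ) (hm : 1 ≤ m) (g p : Fin m → ℝ)
    (hgmono : ∀ i j : Fin m, i ≤ j → g j ≤ g i)
    (hgpos : ∀ i, 0 < g i)
    (hppos : ∀ i, 0 < p i)
    (hpsum : ∑ i, p i = 1)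
    (L : ℝ) (hL : 1.12 ≤ L) :
    ∃ k : Fin m → Fin m → ℝ,
      (∀ i j : Fin m, j < i → 0 ≤ k i j) ∧
      (∀ i : Fin m, ∑ j ∈ univ.filter (fun j => j < i), k i j * p j ≤ 1) ∧
      ∑ i, (p i / g i) *
          Real.exp (∑ j ∈ univ.filter (fun j => j < i),
            (Real.log (g i / g j) * k i j + (1 / L) * psi (k i j)) * p j)
        ≤ 1 / ∑ i, p i * g i := by
  have hLpos : 0 < L := by linarith
  set h : Fin m → ℝ := fun i => Real.log (g i) with hh
  have hexp : ∀ i, Real.exp (h i) = g i := fun i => Real.exp_log (hgpos i)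
  have hanti : Antitone h := fun i j hij => Real.log_le_log (hgpos j) (hgmono i j hij)
  set o : Fin m := ⟨0, hm⟩
  have hb : ∀ i, h i ≤ h o := fun i => hanti (Fin.mk_le_of_le_val (Nat.zero_le _))
  obtain ⟨s, hsb, hbs, hc, hsat⟩ := exists_saturation_level (p := p) hLpos hb
  choose k hk0 hk1 hk using
    exists_kernel_row hLpos hanti hppos o rfl hb hsb hbs hc hsat
  refine ⟨k, fun i j _ => hk0 i j, hk1, ?_⟩
  calc _ = ∑ i, p i * quadWeight L p h (max (h i) s) := by
        refine Finset.sum_congr rfl fun i _ => ?_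
        rw [← hk i, Real.exp_neg, hexp, ← mul_assoc, ← div_eq_mul_inv]
        simp only [hh, fun j => Real.log_div (hgpos i).ne' (hgpos j).ne']
    _ ≤ 1 / ∑ i, p i * Real.exp (max (h i) s) :=
        sum_quadWeight_le hL hppos hpsum hb hsb hbs
    _ ≤ _ := by
        refine one_div_le_one_div_of_le
          (Finset.sum_pos (fun i _ => mul_pos (hppos i) (hgpos i)) ⟨o, Finset.mem_univ o⟩) ?_
        refine Finset.sum_le_sum fun i _ => mul_le_mul_of_nonneg_left ?_ (hppos i).le
        rw [← hexp i]
        exact Real.exp_le_exp.2 (le_max_left _ _)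
end

section
/- Let L ≥ 1.12 and let n ≥ 1. For every subset A ⊆ Ωⁿ with P(A) > 0, one has ∫_{Ωⁿ} exp( (1/L)·m(A,x) ) dP(x) ≤ 1/P(A). -/
open Finset

/-- m(ν,x) = Σ_{i≤n} Σ_{ω∈Ω} ψ(d_i(ω)) μ({ω}), where
d_i(ω) = ν({y : y_i = ω ∧ y_i ≠ x_i}) / μ({ω}). -/
noncomputable def mNu {Ω : Type*} [Fintype Ω] [DecidableEq Ω] {n : ℕ}
    (μ : Ω → ℝ) (ν : (Fin n → Ω) → ℝ) (x : Fin n → Ω) : ℝ :=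
  ∑ i : Fin n, ∑ ω : Ω,
    psi ((∑ y ∈ univ.filter (fun y : Fin n → Ω => y i = ω ∧ y i ≠ x i), ν y) / μ ω) * μ ω

/-- m(A,x) = inf { m(ν,x) : ν a probability measure on Ωⁿ with ν(A) = 1 }. -/
noncomputable def mA {Ω : Type*} [Fintype Ω] [DecidableEq Ω] {n : ℕ}
    (μ : Ω → ℝ) (A : Finset (Fin n → Ω)) (x : Fin n → Ω) : ℝ :=
  sInf { r : ℝ | ∃ ν : (Fin n → Ω) → ℝ,
    (∀ y, 0 ≤ ν y) ∧ (∑ y, ν y = 1) ∧ (∑ y ∈ A, ν y = 1) ∧ r = mNu μ ν x }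

lemma cosh_le_one_add_mul_sq {x : ℝ} (hx : |x| ≤ 25 / 28) :
    Real.cosh x ≤ 1 + 107 / 200 * x ^ 2 := by
  have hx1 : |x| ≤ 1 := hx.trans (by norm_num)
  have h1 := (abs_le.1 (Real.exp_bound hx1 (n := 6) (by norm_num))).2
  have h2 := (abs_le.1 (Real.exp_bound (x := -x) (by rwa [abs_neg]) (n := 6) (by norm_num))).2
  have h6 : |x| ^ 6 = x ^ 6 := by
    rw [show (6 : ℕ) = 2 * 3 from rfl, pow_mul, pow_mul, sq_abs]
  rw [abs_neg] at h2
  rw [h6] at h1 h2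
  simp only [Finset.sum_range_succ, Finset.sum_range_zero, Nat.factorial] at h1 h2
  norm_num at h1 h2
  have hs : x ^ 2 ≤ 625 / 784 := by
    have := abs_le.1 hx
    nlinarith
  rw [Real.cosh_eq]
  have h0 := sq_nonneg x
  have h4 : x ^ 4 ≤ 625 / 784 * x ^ 2 := by nlinarith
  have h6' : x ^ 6 ≤ 625 / 784 * x ^ 4 := by nlinarith [mul_nonneg (sq_nonneg (x ^ 2)) (sub_nonneg.2 hs)]
  nlinarith

lemma exp_neg_le_quadratic {q : ℝ} (hq : 0 ≤ q) : Real.exp (-q) ≤ 1 - q + q ^ 2 / 2 := by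
  have h := Real.quadratic_le_exp_of_nonneg hq
  have h2 : (1 - q + q ^ 2 / 2) * (1 + q + q ^ 2 / 2) = 1 + q ^ 4 / 4 := by ring
  have h3 : Real.exp (-q) * Real.exp q = 1 := by rw [← Real.exp_add]; simp
  have h4 : 0 < 1 - q + q ^ 2 / 2 := by nlinarith [sq_nonneg (q - 1)]
  have h5 : 1 ≤ (1 - q + q ^ 2 / 2) * Real.exp q := by
    nlinarith [mul_le_mul_of_nonneg_left h h4.le, sq_nonneg (q ^ 2)]
  have := Real.exp_pos q
  nlinarith

lemma exp_pair_le {D z w : ℝ} (hD : |D| ≤ 25 / 28) (hz : 0 ≤ z) (hw : 0 ≤ w)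
    (hz' : z ≤ 25 / 56) (hw' : w ≤ 25 / 56) (h : (z - w) ^ 2 ≤ D * (z - w)) :
    (Real.exp (D - z) + Real.exp (-D - w)) / 2 ≤
      1 - (z + w) / 2 + z * w / 2 + 107 / 200 * D ^ 2 * (1 - 87 / 112 * ((z + w) / 2)) := by
  set q := (z + w) / 2 with hq
  set v := D - (z - w) / 2 with hv
  have hq0 : 0 ≤ q := by linarith
  have hq1 : q ≤ 25 / 56 := by linarith
  have hv2 : v ^ 2 ≤ D ^ 2 - 3 / 4 * (z - w) ^ 2 := by rw [hv]; nlinarith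
  have hv1 : |v| ≤ 25 / 28 := by
    refine le_trans (sq_le_sq.1 ?_) hD
    nlinarith [sq_nonneg (z - w)]
  have e1 : (Real.exp (D - z) + Real.exp (-D - w)) / 2 = Real.exp (-q) * Real.cosh v := by
    rw [Real.cosh_eq, mul_div_assoc', mul_add, ← Real.exp_add, ← Real.exp_add]
    congr 3 <;> (rw [hq, hv]; ring)
  have hE := exp_neg_le_quadratic hq0
  have hC := cosh_le_one_add_mul_sq hv1
  have hlin : 1 - q + q ^ 2 / 2 ≤ 1 - 87 / 112 * q := by nlinarith
  set B := D ^ 2 - 3 / 4 * (z - w) ^ 2 with hB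
  have hB0 : 0 ≤ B := (sq_nonneg v).trans hv2
  have hpos : 0 < 1 - q + q ^ 2 / 2 := by nlinarith
  calc _ = Real.exp (-q) * Real.cosh v := e1
    _ ≤ (1 - q + q ^ 2 / 2) * (1 + 107 / 200 * B) := by
        refine mul_le_mul hE (by linarith) (Real.cosh_pos v).le hpos.le
    _ ≤ 1 - q + q ^ 2 / 2 + 107 / 200 * B * (1 - 87 / 112 * q) := by
        nlinarith [mul_le_mul_of_nonneg_right hlin hB0]
    _ ≤ _ := by
        have : q ^ 2 = z * w + (z - w) ^ 2 / 4 := by rw [hq]; ring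
        have h3 : 65 / 100 * (z - w) ^ 2 ≤ (1 - 87 / 112 * q) * (z - w) ^ 2 :=
          mul_le_mul_of_nonneg_right (by linarith) (sq_nonneg _)
        rw [hB, this]
        nlinarith [sq_nonneg (z - w)]

lemma max_sq_sub_max_sq {a b c : ℝ} (ha : 0 ≤ a) (hab : a ≤ b) (hc : 0 ≤ c) :
    0 ≤ max (c - a) 0 ^ 2 - max (c - b) 0 ^ 2 ∧
      max (c - a) 0 ^ 2 - max (c - b) 0 ^ 2 ≤ 2 * (b - a) * c := by
  rcases le_total (c - a) 0 with h1 | h1 <;> rcases le_total (c - b) 0 with h2 | h2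
  all_goals simp only [h1, h2, max_eq_left, max_eq_right]
  all_goals constructor <;> nlinarith [mul_nonneg (sub_nonneg.2 hab) hc, mul_nonneg (sub_nonneg.2 hab) ha]

/-- The one-dimensional penalty of `x` for the truncated profile `u`. -/
noncomputable def penalty {Ω : Type*} [Fintype Ω] (μ u : Ω → ℝ) (x : Ω) : ℝ :=
  28 / 25 * ∑ y, μ y * max (u y - u x) 0 ^ 2

section penalty

variable {Ω : Type*} [Fintype Ω] {μ u : Ω → ℝ}

lemma penalty_nonneg (hμ : ∀ x, 0 ≤ μ x) (x : Ω) : 0 ≤ penalty μ u x :=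
  mul_nonneg (by norm_num) (sum_nonneg fun y _ => mul_nonneg (hμ y) (sq_nonneg _))

lemma penalty_le (hμ : ∀ x, 0 ≤ μ x) (hu : ∀ x, 0 ≤ u x) (hu' : ∀ x, u x ≤ 25 / 28)
    (hsum : ∑ x, μ x * u x ≤ 25 / 56) (x : Ω) : penalty μ u x ≤ 25 / 56 := by
  have : ∑ y, μ y * max (u y - u x) 0 ^ 2 ≤ ∑ y, 25 / 28 * (μ y * u y) := by
    refine sum_le_sum fun y _ => ?_
    have h1 : max (u y - u x) 0 ≤ u y := max_le (by linarith [hu x]) (hu y)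
    have h2 : 0 ≤ max (u y - u x) 0 := le_max_right _ _
    have h3 : max (u y - u x) 0 ^ 2 ≤ 25 / 28 * u y := by nlinarith [hu' y]
    nlinarith [mul_le_mul_of_nonneg_left h3 (hμ y)]
  rw [← mul_sum] at this
  rw [penalty]
  linarith

lemma penalty_sub_penalty (hμ : ∀ x, 0 ≤ μ x) (hu : ∀ x, 0 ≤ u x)
    (hsum : ∑ x, μ x * u x ≤ 25 / 56) {x y : Ω} (hxy : u x ≤ u y) :
    0 ≤ penalty μ u x - penalty μ u y ∧ penalty μ u x - penalty μ u y ≤ u y - u x := by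
  have e : penalty μ u x - penalty μ u y =
      28 / 25 * ∑ w, μ w * (max (u w - u x) 0 ^ 2 - max (u w - u y) 0 ^ 2) := by
    simp only [penalty, mul_sub, sum_sub_distrib]
  rw [e]
  constructor
  · exact mul_nonneg (by norm_num) (sum_nonneg fun w _ =>
      mul_nonneg (hμ w) (max_sq_sub_max_sq (hu x) hxy (hu w)).1)
  · have : ∑ w, μ w * (max (u w - u x) 0 ^ 2 - max (u w - u y) 0 ^ 2) ≤
        ∑ w, 2 * (u y - u x) * (μ w * u w) := by
      refine sum_le_sum fun w _ => ?_
      nlinarith [mul_le_mul_of_nonneg_left (max_sq_sub_max_sq (hu x) hxy (hu w)).2 (hμ w)]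
    rw [← mul_sum] at this
    nlinarith [mul_le_mul_of_nonneg_left hsum (sub_nonneg.2 hxy)]

lemma sq_penalty_sub_le (hμ : ∀ x, 0 ≤ μ x) (hu : ∀ x, 0 ≤ u x)
    (hsum : ∑ x, μ x * u x ≤ 25 / 56) (x y : Ω) :
    (penalty μ u x - penalty μ u y) ^ 2 ≤ (u y - u x) * (penalty μ u x - penalty μ u y) := by
  rcases le_total (u x) (u y) with h | h
  · obtain ⟨h1, h2⟩ := penalty_sub_penalty hμ hu hsum h
    nlinarith
  · obtain ⟨h1, h2⟩ := penalty_sub_penalty hμ hu hsum h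
    nlinarith

lemma sum_mul_penalty (hμ1 : ∑ x, μ x = 1) :
    ∑ x, μ x * penalty μ u x = 28 / 25 * (∑ x, μ x * u x ^ 2 - (∑ x, μ x * u x) ^ 2) := by
  have h1 : ∑ x, μ x * penalty μ u x =
      28 / 25 * ∑ x, ∑ y, μ x * μ y * max (u y - u x) 0 ^ 2 := by
    simp only [penalty, mul_sum]
    exact sum_congr rfl fun x _ => sum_congr rfl fun y _ => by ring
  have h2 : ∑ x, ∑ y, μ x * μ y * max (u y - u x) 0 ^ 2 =
      ∑ x, ∑ y, μ x * μ y * max (u x - u y) 0 ^ 2 := by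
    rw [sum_comm]
    exact sum_congr rfl fun x _ => sum_congr rfl fun y _ => by ring
  have h3 : ∑ x, ∑ y, μ x * μ y * max (u y - u x) 0 ^ 2 +
      ∑ x, ∑ y, μ x * μ y * max (u x - u y) 0 ^ 2 =
      ∑ x, ∑ y, μ x * μ y * (u x ^ 2 - 2 * (u x * u y) + u y ^ 2) := by
    simp only [← sum_add_distrib]
    refine sum_congr rfl fun x _ => sum_congr rfl fun y _ => ?_
    rcases le_total (u x) (u y) with h | h
    · rw [max_eq_left (sub_nonneg.2 h), max_eq_right (sub_nonpos.2 h)]; ring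
    · rw [max_eq_right (sub_nonpos.2 h), max_eq_left (sub_nonneg.2 h)]; ring
  have h4 : ∑ x, ∑ y, μ x * μ y * (u x ^ 2 - 2 * (u x * u y) + u y ^ 2) =
      2 * (∑ x, μ x * u x ^ 2 - (∑ x, μ x * u x) ^ 2) := by
    have : ∀ x y, μ x * μ y * (u x ^ 2 - 2 * (u x * u y) + u y ^ 2) =
        (μ x * u x ^ 2) * μ y - 2 * ((μ x * u x) * (μ y * u y)) + μ x * (μ y * u y ^ 2) := by
      intros; ring
    simp only [this, sum_add_distrib, sum_sub_distrib, ← mul_sum, ← sum_mul, hμ1]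
    ring
  rw [h1]
  linarith

theorem sum_exp_neg_penalty_mul_sum_exp_le (hμ : ∀ x, 0 ≤ μ x) (hμ1 : ∑ x, μ x = 1)
    (hu : ∀ x, 0 ≤ u x) (hu' : ∀ x, u x ≤ 25 / 28) (hsum : ∑ x, μ x * u x ≤ 25 / 56) :
    (∑ x, μ x * Real.exp (-u x - penalty μ u x)) * ∑ y, μ y * Real.exp (u y) ≤ 1 := by
  set z := penalty μ u with hz
  set m := ∑ x, μ x * u x with hm
  set M := ∑ x, μ x * u x ^ 2 with hM
  have hZ : ∑ x, μ x * z x = 28 / 25 * (M - m ^ 2) := sum_mul_penalty hμ1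
  have hz0 : ∀ x, 0 ≤ z x := penalty_nonneg hμ
  have hz1 : ∀ x, z x ≤ 25 / 56 := penalty_le hμ hu hu' hsum
  have hsym : (∑ x, μ x * Real.exp (-u x - z x)) * ∑ y, μ y * Real.exp (u y) =
      ∑ x, ∑ y, μ x * μ y *
        ((Real.exp ((u y - u x) - z x) + Real.exp (-(u y - u x) - z y)) / 2) := by
    have e1 : (∑ x, μ x * Real.exp (-u x - z x)) * ∑ y, μ y * Real.exp (u y) =
        ∑ x, ∑ y, μ x * μ y * Real.exp ((u y - u x) - z x) := by
      rw [sum_mul_sum]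
      refine sum_congr rfl fun x _ => sum_congr rfl fun y _ => ?_
      rw [show (u y - u x) - z x = (-u x - z x) + u y by ring, Real.exp_add]
      ring
    have e2 : ∑ x, ∑ y, μ x * μ y * Real.exp ((u y - u x) - z x) =
        ∑ x, ∑ y, μ x * μ y * Real.exp (-(u y - u x) - z y) := by
      rw [sum_comm]
      refine sum_congr rfl fun x _ => sum_congr rfl fun y _ => ?_
      rw [neg_sub, mul_comm (μ y)]
    have e3 : ∑ x, ∑ y, μ x * μ y *
        ((Real.exp ((u y - u x) - z x) + Real.exp (-(u y - u x) - z y)) / 2) =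
        (∑ x, ∑ y, μ x * μ y * Real.exp ((u y - u x) - z x) +
          ∑ x, ∑ y, μ x * μ y * Real.exp (-(u y - u x) - z y)) / 2 := by
      simp only [← sum_add_distrib, sum_div]
      exact sum_congr rfl fun x _ => sum_congr rfl fun y _ => by ring
    rw [e3, e1]
    linarith
  have hle : ∑ x, ∑ y, μ x * μ y *
        ((Real.exp ((u y - u x) - z x) + Real.exp (-(u y - u x) - z y)) / 2) ≤
      ∑ x, ∑ y, μ x * μ y * (1 - (z x + z y) / 2 + z x * z y / 2 +
        107 / 200 * (u y - u x) ^ 2 * (1 - 87 / 112 * ((z x + z y) / 2))) := by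
    refine sum_le_sum fun x _ => sum_le_sum fun y _ =>
      mul_le_mul_of_nonneg_left ?_ (mul_nonneg (hμ x) (hμ y))
    refine exp_pair_le ?_ (hz0 x) (hz0 y) (hz1 x) (hz1 y) (sq_penalty_sub_le hμ hu hsum x y)
    rw [abs_le]
    constructor <;> linarith [hu x, hu y, hu' x, hu' y]
  have hcomp : ∑ x, ∑ y, μ x * μ y * (1 - (z x + z y) / 2 + z x * z y / 2 +
        107 / 200 * (u y - u x) ^ 2 * (1 - 87 / 112 * ((z x + z y) / 2))) =
      1 - ∑ x, μ x * z x + (∑ x, μ x * z x) ^ 2 / 2 + 107 / 200 * (2 * (M - m ^ 2)) -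
        107 / 200 * (87 / 112) * (M * ∑ x, μ x * z x - 2 * m * ∑ x, μ x * (z x * u x) +
          ∑ x, μ x * (z x * u x ^ 2)) := by
    have : ∀ x y, μ x * μ y * (1 - (z x + z y) / 2 + z x * z y / 2 +
        107 / 200 * (u y - u x) ^ 2 * (1 - 87 / 112 * ((z x + z y) / 2))) =
        μ x * μ y - (1 / 2) * ((μ x * z x) * μ y) - (1 / 2) * (μ x * (μ y * z y)) +
        (1 / 2) * ((μ x * z x) * (μ y * z y)) + 107 / 200 * ((μ x * u x ^ 2) * μ y)
        + 107 / 200 * (μ x * (μ y * u y ^ 2)) - 2 * (107 / 200) * ((μ x * u x) * (μ y * u y))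
        - 107 / 200 * (87 / 112) / 2 * ((μ x * z x) * (μ y * u y ^ 2))
        - 107 / 200 * (87 / 112) / 2 * ((μ x * u x ^ 2) * (μ y * z y))
        + 107 / 200 * (87 / 112) * ((μ x * (z x * u x)) * (μ y * u y))
        + 107 / 200 * (87 / 112) * ((μ x * u x) * (μ y * (z y * u y)))
        - 107 / 200 * (87 / 112) / 2 * ((μ x * (z x * u x ^ 2)) * μ y)
        - 107 / 200 * (87 / 112) / 2 * (μ x * (μ y * (z y * u y ^ 2))) := by
      intros; ring
    simp only [this, sum_add_distrib, sum_sub_distrib, ← mul_sum, ← sum_mul, hμ1]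
    ring
  have hV : (M - m ^ 2) * ∑ x, μ x * z x ≤ M * ∑ x, μ x * z x -
      2 * m * ∑ x, μ x * (z x * u x) + ∑ x, μ x * (z x * u x ^ 2) := by
    have : 0 ≤ ∑ x, μ x * z x * (u x - m) ^ 2 :=
      sum_nonneg fun x _ => mul_nonneg (mul_nonneg (hμ x) (hz0 x)) (sq_nonneg _)
    have e : ∀ x, μ x * z x * (u x - m) ^ 2 =
        μ x * (z x * u x ^ 2) - 2 * m * (μ x * (z x * u x)) + m ^ 2 * (μ x * z x) := by
      intros; ring
    simp only [e, sum_add_distrib, sum_sub_distrib, ← mul_sum] at this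
    linarith
  have hMm : M ≤ 25 / 28 * m := by
    rw [hM, hm, mul_sum]
    refine sum_le_sum fun x _ => ?_
    nlinarith [mul_nonneg (hμ x) (mul_nonneg (hu x) (sub_nonneg.2 (hu' x)))]
  have hZ0 : 0 ≤ ∑ x, μ x * z x := sum_nonneg fun x _ => mul_nonneg (hμ x) (hz0 x)
  rw [hsym]
  refine hle.trans ?_
  rw [hcomp]
  rw [hZ] at *
  set V := M - m ^ 2
  have hV0 : 0 ≤ V := by linarith
  have hV1 : V ≤ 625 / 3136 := by nlinarith [sq_nonneg (m - 25 / 56)]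
  nlinarith [mul_nonneg hV0 (sub_nonneg.2 hV1)]

end penalty

lemma psi_zero : psi 0 = 0 := by norm_num [psi]

lemma psi_nonneg (x : ℝ) : 0 ≤ psi x := by
  unfold psi
  split_ifs with h
  · positivity
  · linarith

lemma psi_of_le {x : ℝ} (h : x ≤ 2) : psi x = x ^ 2 / 4 := if_pos h

lemma psi_of_ge {x : ℝ} (h : 2 ≤ x) : psi x = x - 1 := by
  unfold psi
  split_ifs with h'
  · rw [le_antisymm h' h]; norm_num
  · rfl

lemma psi_tangent (x y : ℝ) : psi x + min x 2 / 2 * (y - x) ≤ psi y := by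
  rcases le_total x 2 with hx | hx <;> rcases le_total y 2 with hy | hy
  all_goals simp only [hx, hy, psi_of_le, psi_of_ge, min_eq_left, min_eq_right]
  all_goals nlinarith [sq_nonneg (x - y), mul_nonneg (sub_nonneg.2 hx) (sub_nonneg.2 hy),
    sq_nonneg (x - 2), sq_nonneg (y - 2)]

lemma psi_sum_le {ι : Type*} [Fintype ι] {p : ι → ℝ} (hp : ∀ i, 0 ≤ p i) (hp1 : ∑ i, p i = 1)
    (d : ι → ℝ) : psi (∑ i, p i * d i) ≤ ∑ i, p i * psi (d i) := by
  set D := ∑ i, p i * d i with hD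
  have h : ∑ i, p i * (psi D + min D 2 / 2 * (d i - D)) ≤ ∑ i, p i * psi (d i) :=
    sum_le_sum fun i _ => mul_le_mul_of_nonneg_left (psi_tangent _ _) (hp i)
  have e : ∀ i, p i * (psi D + min D 2 / 2 * (d i - D)) =
      p i * (psi D - min D 2 / 2 * D) + min D 2 / 2 * (p i * d i) := by intros; ring
  simp only [e, sum_add_distrib, ← sum_mul, ← mul_sum, hp1, ← hD] at h
  linarith

lemma exists_level {Ω : Type*} [Fintype Ω] (μ f : Ω → ℝ)
    (hf : ∃ x, 0 < f x) :
    ∃ (T : ℝ) (u : Ω → ℝ) (w : Ω), (∀ x, 0 ≤ u x) ∧ (∀ x, u x ≤ 25 / 28) ∧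
      (∀ x, f x ≤ Real.exp (u x - T)) ∧
      (∀ x, 0 < u x → 0 < f x ∧ -Real.log (f x) = T - u x) ∧ 0 < f w ∧
      ∑ x, μ x * u x ≤ 25 / 56 ∧ (∑ x, μ x * u x = 25 / 56 ∨ u w = 25 / 28) := by
  obtain ⟨x₀, hx₀⟩ := hf
  obtain ⟨w, -, hw⟩ := exists_max_image univ f ⟨x₀, mem_univ _⟩
  have hw0 : 0 < f w := hx₀.trans_le (hw x₀ (mem_univ _))
  set u : ℝ → Ω → ℝ := fun T x => if 0 < f x then max (T + Real.log (f x)) 0 else 0 with hu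
  have hcont : Continuous fun T => ∑ x, μ x * u T x := by
    refine continuous_finsetSum _ fun x _ => ?_
    simp only [hu]
    split_ifs <;> fun_prop
  have hzero : ∑ x, μ x * u (-Real.log (f w)) x = 0 := by
    refine sum_eq_zero fun x _ => ?_
    simp only [hu]
    split_ifs with h
    · rw [max_eq_right, mul_zero]
      linarith [Real.log_le_log h (hw x (mem_univ _))]
    · simp
  have key : ∃ T ≤ -Real.log (f w) + 25 / 28, ∑ x, μ x * u T x ≤ 25 / 56 ∧
      (∑ x, μ x * u T x = 25 / 56 ∨ u T w = 25 / 28) := by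
    rcases le_total (∑ x, μ x * u (-Real.log (f w) + 25 / 28) x) (25 / 56) with h | h
    · refine ⟨_, le_rfl, h, Or.inr ?_⟩
      simp only [hu, hw0, if_true]
      rw [max_eq_left] <;> norm_num
    · obtain ⟨T, hT, hT'⟩ := intermediate_value_Icc
        (show -Real.log (f w) ≤ -Real.log (f w) + 25 / 28 by norm_num) hcont.continuousOn
        (show (25 / 56 : ℝ) ∈ Set.Icc _ _ from ⟨by rw [hzero]; norm_num, h⟩)
      exact ⟨T, hT.2, le_of_eq hT', Or.inl hT'⟩
  obtain ⟨T, hT, h1, h2⟩ := key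
  refine ⟨T, u T, w, fun x => ?_, fun x => ?_, fun x => ?_, fun x hx => ?_, hw0, h1, h2⟩
  · simp only [hu]
    split_ifs
    · exact le_max_right _ _
    · exact le_rfl
  · simp only [hu]
    split_ifs with h
    · refine max_le ?_ (by norm_num)
      linarith [Real.log_le_log h (hw x (mem_univ _))]
    · norm_num
  · by_cases h : 0 < f x
    · rw [← Real.log_le_iff_le_exp h]
      simp only [hu, h, if_true]
      linarith [le_max_left (T + Real.log (f x)) 0]
    · exact (not_lt.1 h).trans (Real.exp_pos _).le
  · simp only [hu] at hx ⊢
    split_ifs at hx ⊢ with h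
    · refine ⟨h, ?_⟩
      rcases lt_max_iff.1 hx with h' | h'
      · rw [max_eq_left h'.le]; ring
      · exact absurd h' (lt_irrefl _)
    · exact absurd hx (lt_irrefl _)

lemma exists_weights_aux {Ω : Type*} [Fintype Ω] [DecidableEq Ω] {μ f u : Ω → ℝ} {T : ℝ}
    (hμ : ∀ x, 0 < μ x) (hu : ∀ x, 0 ≤ u x) (hu' : ∀ x, u x ≤ 25 / 28)
    (hf : ∀ x, 0 < u x → 0 < f x ∧ -Real.log (f x) = T - u x)
    (hsum : ∑ x, μ x * u x ≤ 25 / 56) (x v : Ω) (hfv : 0 < f v)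
    (hv : (v = x ∧ 0 < u x) ∨
      (u x = 0 ∧ (∑ x, μ x * u x = 25 / 56 ∨ u v = 25 / 28))) :
    ∃ p : Ω → ℝ, (∀ y, 0 ≤ p y) ∧ ∑ y, p y = 1 ∧ (∀ y, p y ≠ 0 → 0 < f y) ∧
      25 / 28 * ∑ y, (if y = x then 0 else psi (p y / μ y) * μ y) -
        ∑ y, p y * Real.log (f y) ≤ T - u x - penalty μ u x := by
  set h : Ω → ℝ := fun y => 56 / 25 * max (u y - u x) 0 with hh
  have h0 : ∀ y, 0 ≤ h y := fun y => mul_nonneg (by norm_num) (le_max_right _ _)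
  have hle : ∀ y, h y ≤ 56 / 25 * u y := fun y =>
    mul_le_mul_of_nonneg_left (max_le (by linarith [hu x]) (hu y)) (by norm_num)
  have h2 : ∀ y, h y ≤ 2 := fun y => (hle y).trans (by linarith [hu' y])
  have hpos : ∀ y, h y ≠ 0 → 0 < u y := fun y hy => by
    have := lt_of_le_of_ne (h0 y) (Ne.symm hy)
    linarith [hle y]
  set r := 1 - ∑ y, μ y * h y with hr
  have hr0 : 0 ≤ r := by
    have : ∑ y, μ y * h y ≤ ∑ y, 56 / 25 * (μ y * u y) :=
      sum_le_sum fun y _ => by nlinarith [mul_le_mul_of_nonneg_left (hle y) (hμ y).le]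
    rw [← mul_sum] at this
    linarith
  have hterm : ∀ y, 25 / 28 * (if y = x then 0 else psi (h y) * μ y) -
      μ y * h y * Real.log (f y) ≤ 25 / 28 * (μ y * h y ^ 2 / 4) + μ y * h y * (T - u y) := by
    intro y
    have e : μ y * h y * (T - u y) = - (μ y * h y * Real.log (f y)) := by
      by_cases hy : h y = 0
      · simp [hy]
      · rw [← (hf y (hpos y hy)).2]; ring
    rw [e, psi_of_le (h2 y)]
    have := mul_nonneg (hμ y).le (sq_nonneg (h y))
    split_ifs <;> linarith
  refine ⟨fun y => μ y * h y + if y = v then r else 0, fun y => ?_, ?_, fun y hy => ?_, ?_⟩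
  · have := mul_nonneg (hμ y).le (h0 y)
    dsimp only
    split_ifs <;> linarith
  · rw [sum_add_distrib, sum_ite_eq' univ v, if_pos (mem_univ _)]
    linarith
  · by_cases hyv : y = v
    · rwa [hyv]
    · simp only [hyv, if_false, add_zero] at hy
      exact (hf y (hpos y (right_ne_zero_of_mul hy))).1
  · have hbound : ∀ y, 25 / 28 * (if y = x then 0 else
        psi ((μ y * h y + if y = v then r else 0) / μ y) * μ y) -
        (μ y * h y + if y = v then r else 0) * Real.log (f y) ≤
        25 / 28 * (μ y * h y ^ 2 / 4) + μ y * h y * (T - u y) +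
          if y = v then r * (T - u x) else 0 := by
      intro y
      have hdiv : μ y * h y / μ y = h y := mul_div_cancel_left₀ _ (hμ y).ne'
      have ht := hterm y
      by_cases hyv : y = v
      · simp only [hyv, if_true] at *
        rcases hv with ⟨rfl, hx⟩ | ⟨hx, hs⟩
        · have : h v = 0 := by simp [hh]
          have hl := (hf v hx).2
          simp only [this, if_true]
          nlinarith
        · by_cases hr1 : r = 0
          · rw [hr1]
            simp only [add_zero, zero_mul, hdiv]
            exact ht
          · have huv : u v = 25 / 28 := by
              refine hs.resolve_left fun hs => hr1 ?_
              have : ∑ y, μ y * h y = ∑ y, 56 / 25 * (μ y * u y) :=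
                sum_congr rfl fun y _ => by
                  simp only [hh, hx, sub_zero, max_eq_left (hu y)]; ring
              rw [hr, this, ← mul_sum, hs]; norm_num
            have hh2 : h v = 2 := by
              simp only [hh, huv, hx, sub_zero]; norm_num
            have hl := (hf v (by rw [huv]; norm_num)).2
            have hvx : v ≠ x := by rintro rfl; linarith
            have hq : 0 ≤ r / μ v := div_nonneg hr0 (hμ v).le
            have hm : r / μ v * μ v = r := div_mul_cancel₀ _ (hμ v).ne'
            rw [if_neg hvx, add_div, hdiv, hh2, psi_of_ge (by linarith)]
            have hl' : Real.log (f v) = 25 / 28 - T := by linarith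
            rw [hl', hx, huv]
            have : (2 + r / μ v - 1) * μ v = μ v + r := by linear_combination hm
            rw [this]
            apply le_of_eq; ring
      · simp only [hyv, if_false, add_zero, hdiv]
        exact ht
    have hs := sum_le_sum fun y (_ : y ∈ univ) => hbound y
    rw [sum_sub_distrib, ← mul_sum, sum_add_distrib, sum_ite_eq' univ v, if_pos (mem_univ _)] at hs
    refine hs.trans (le_of_eq ?_)
    have e : ∑ y, (25 / 28 * (μ y * h y ^ 2 / 4) + μ y * h y * (T - u y)) =
        (∑ y, μ y * h y) * (T - u x) - penalty μ u x := by
      rw [penalty, mul_sum, sum_mul, ← sum_sub_distrib]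
      refine sum_congr rfl fun y _ => ?_
      have : max (u y - u x) 0 * (u y - u x) = max (u y - u x) 0 ^ 2 := by
        rcases le_total (u y - u x) 0 with h | h
        · rw [max_eq_right h]; ring
        · rw [max_eq_left h]; ring
      simp only [hh]
      linear_combination (-56 / 25) * μ y * this
    rw [e, hr]
    ring

/-- The one-dimensional optimal mixing weights used in the induction on the dimension. -/
theorem exists_weights {Ω : Type*} [Fintype Ω] [DecidableEq Ω] (μ f : Ω → ℝ)
    (hμ : ∀ x, 0 < μ x) (hμ1 : ∑ x, μ x = 1) (hf : ∃ x, 0 < f x) :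
    ∃ p : Ω → Ω → ℝ, (∀ x y, 0 ≤ p x y) ∧ (∀ x, ∑ y, p x y = 1) ∧
      (∀ x y, p x y ≠ 0 → 0 < f y) ∧
      (∑ x, μ x * Real.exp (25 / 28 * ∑ y, (if y = x then 0 else psi (p x y / μ y) * μ y) -
        ∑ y, p x y * Real.log (f y))) * ∑ x, μ x * f x ≤ 1 := by
  have hμ0 := fun x => (hμ x).le
  obtain ⟨T, u, w, hu, hu', hfT, hfu, hfw, hsum, halt⟩ := exists_level μ f hf
  have hex : ∀ x, ∃ p : Ω → ℝ, (∀ y, 0 ≤ p y) ∧ ∑ y, p y = 1 ∧ (∀ y, p y ≠ 0 → 0 < f y) ∧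
      25 / 28 * ∑ y, (if y = x then 0 else psi (p y / μ y) * μ y) -
        ∑ y, p y * Real.log (f y) ≤ T - u x - penalty μ u x := by
    intro x
    rcases (hu x).eq_or_lt with hx | hx
    · exact exists_weights_aux hμ hu hu' hfu hsum x w hfw (Or.inr ⟨hx.symm, halt⟩)
    · exact exists_weights_aux hμ hu hu' hfu hsum x x (hfu x hx).1 (Or.inl ⟨rfl, hx⟩)
  choose p hp0 hp1 hpf hp using hex
  refine ⟨p, hp0, hp1, hpf, ?_⟩
  have h1 : ∑ x, μ x * Real.exp (25 / 28 * ∑ y, (if y = x then 0 else psi (p x y / μ y) * μ y) -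
      ∑ y, p x y * Real.log (f y)) ≤
      Real.exp T * ∑ x, μ x * Real.exp (-u x - penalty μ u x) := by
    rw [mul_sum]
    refine sum_le_sum fun x _ => ?_
    rw [mul_left_comm, ← Real.exp_add]
    refine mul_le_mul_of_nonneg_left (Real.exp_le_exp.2 ?_) (hμ0 x)
    linarith [hp x]
  have h2 : ∑ x, μ x * f x ≤ Real.exp (-T) * ∑ x, μ x * Real.exp (u x) := by
    rw [mul_sum]
    refine sum_le_sum fun x _ => ?_
    rw [mul_left_comm, ← Real.exp_add]
    refine mul_le_mul_of_nonneg_left ((hfT x).trans (le_of_eq ?_)) (hμ0 x)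
    congr 1; ring
  have h3 := sum_exp_neg_penalty_mul_sum_exp_le hμ0 hμ1 hu hu' hsum
  have h4 : Real.exp T * Real.exp (-T) = 1 := by rw [← Real.exp_add]; simp
  have h5 : 0 ≤ ∑ x, μ x * Real.exp (-u x - penalty μ u x) :=
    sum_nonneg fun x _ => mul_nonneg (hμ0 x) (Real.exp_pos _).le
  have h6 : 0 ≤ ∑ x, μ x * Real.exp (u x) :=
    sum_nonneg fun x _ => mul_nonneg (hμ0 x) (Real.exp_pos _).le
  have h7 : 0 ≤ ∑ x, μ x * Real.exp (25 / 28 *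
      ∑ y, (if y = x then 0 else psi (p x y / μ y) * μ y) - ∑ y, p x y * Real.log (f y)) :=
    sum_nonneg fun x _ => mul_nonneg (hμ0 x) (Real.exp_pos _).le
  calc _ ≤ (Real.exp T * ∑ x, μ x * Real.exp (-u x - penalty μ u x)) *
        (Real.exp (-T) * ∑ x, μ x * Real.exp (u x)) :=
      (mul_le_mul_of_nonneg_left h2 h7).trans
        (mul_le_mul_of_nonneg_right h1 (mul_nonneg (Real.exp_pos _).le h6))
    _ = (∑ x, μ x * Real.exp (-u x - penalty μ u x)) * ∑ x, μ x * Real.exp (u x) := by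
      linear_combination ((∑ x, μ x * Real.exp (-u x - penalty μ u x)) *
        ∑ x, μ x * Real.exp (u x)) * h4
    _ ≤ 1 := h3

lemma sum_fin_succ_fun {Ω : Type*} [Fintype Ω] {n : ℕ} (F : (Fin (n + 1) → Ω) → ℝ) :
    ∑ z, F z = ∑ ω, ∑ y : Fin n → Ω, F (Fin.cons ω y) := by
  rw [← (Fin.consEquiv fun _ : Fin (n + 1) => Ω).sum_comp, Fintype.sum_prod_type]
  rfl

lemma exp_sum_mul_le {ι : Type*} [Fintype ι] {p f m : ι → ℝ} (hp : ∀ ω, 0 ≤ p ω) (hp1 : ∑ ω, p ω = 1)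
    (hpf : ∀ ω, p ω ≠ 0 → 0 < f ω) :
    Real.exp (∑ ω, p ω * m ω) ≤
      Real.exp (-∑ ω, p ω * Real.log (f ω)) * ∑ ω, p ω * (f ω * Real.exp (m ω)) := by
  have h := convexOn_exp.map_sum_le (t := univ) (w := p) (p := fun ω => m ω + Real.log (f ω))
    (fun ω _ => hp ω) hp1 (fun _ _ => Set.mem_univ _)
  simp only [smul_eq_mul] at h
  have e : ∑ ω, p ω * Real.exp (m ω + Real.log (f ω)) = ∑ ω, p ω * (f ω * Real.exp (m ω)) := by
    refine sum_congr rfl fun ω _ => ?_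
    by_cases h0 : p ω = 0
    · simp [h0]
    · rw [Real.exp_add, Real.exp_log (hpf ω h0), mul_comm (f ω)]
  rw [e] at h
  have h2 := mul_le_mul_of_nonneg_left h (Real.exp_pos (-∑ ω, p ω * Real.log (f ω))).le
  rw [← Real.exp_add] at h2
  refine le_trans (le_of_eq ?_) h2
  congr 1
  simp only [mul_add, sum_add_distrib]
  ring

section tensorization

variable {Ω : Type*} [Fintype Ω] [DecidableEq Ω] {n : ℕ} {μ : Ω → ℝ}

lemma mNu_nonneg (hμ : ∀ ω, 0 ≤ μ ω) (ν : (Fin n → Ω) → ℝ) (x : Fin n → Ω) :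
    0 ≤ mNu μ ν x :=
  sum_nonneg fun _ _ => sum_nonneg fun ω _ => mul_nonneg (psi_nonneg _) (hμ ω)

lemma mA_nonneg (hμ : ∀ ω, 0 ≤ μ ω) (A : Finset (Fin n → Ω)) (x : Fin n → Ω) :
    0 ≤ mA μ A x := by
  refine Real.sInf_nonneg ?_
  rintro r ⟨ν, -, -, -, rfl⟩
  exact mNu_nonneg hμ ν x

lemma mA_le_mNu (hμ : ∀ ω, 0 ≤ μ ω) {A : Finset (Fin n → Ω)} (x : Fin n → Ω)
    {ν : (Fin n → Ω) → ℝ} (h0 : ∀ y, 0 ≤ ν y) (h1 : ∑ y, ν y = 1) (hA : ∑ y ∈ A, ν y = 1) :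
    mA μ A x ≤ mNu μ ν x := by
  refine csInf_le ⟨0, ?_⟩ ⟨ν, h0, h1, hA, rfl⟩
  rintro r ⟨ν, -, -, -, rfl⟩
  exact mNu_nonneg hμ ν x

lemma exists_mNu_lt {A : Finset (Fin n → Ω)} (hA : A.Nonempty) (x : Fin n → Ω)
    {ε : ℝ} (hε : 0 < ε) :
    ∃ ν : (Fin n → Ω) → ℝ, (∀ y, 0 ≤ ν y) ∧ ∑ y, ν y = 1 ∧ ∑ y ∈ A, ν y = 1 ∧
      mNu μ ν x < mA μ A x + ε := by
  obtain ⟨a, ha⟩ := hA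
  have hne : { r : ℝ | ∃ ν : (Fin n → Ω) → ℝ, (∀ y, 0 ≤ ν y) ∧ (∑ y, ν y = 1) ∧
      (∑ y ∈ A, ν y = 1) ∧ r = mNu μ ν x }.Nonempty := by
    refine ⟨_, fun y => if y = a then 1 else 0, fun y => ?_, ?_, ?_, rfl⟩
    · dsimp only
      split_ifs <;> norm_num
    · simp
    · simp [ha]
  obtain ⟨r, ⟨ν, h0, h1, h2, rfl⟩, hr⟩ :=
    exists_lt_of_csInf_lt hne (lt_add_of_pos_right (mA μ A x) hε)
  exact ⟨ν, h0, h1, h2, hr⟩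

/-- The section of `A` over the value `ω` of the first coordinate. -/
def consSection (A : Finset (Fin (n + 1) → Ω)) (ω : Ω) : Finset (Fin n → Ω) :=
  univ.filter fun y => (Fin.cons ω y : Fin (n + 1) → Ω) ∈ A

lemma sum_mem_eq_sum_consSection (A : Finset (Fin (n + 1) → Ω)) (F : (Fin (n + 1) → Ω) → ℝ) :
    ∑ z ∈ A, F z = ∑ ω, ∑ y ∈ consSection A ω, F (Fin.cons ω y) := by
  rw [← Fintype.sum_ite_mem, sum_fin_succ_fun]
  simp only [consSection, sum_filter]

lemma mA_cons_le (hμ : ∀ ω, 0 ≤ μ ω) (A : Finset (Fin (n + 1) → Ω)) {p : Ω → ℝ}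
    (hp : ∀ ω, 0 ≤ p ω) (hp1 : ∑ ω, p ω = 1) (hpA : ∀ ω, p ω ≠ 0 → (consSection A ω).Nonempty)
    (x₀ : Ω) (x : Fin n → Ω) :
    mA μ A (Fin.cons x₀ x) ≤ ∑ ω, (if ω = x₀ then 0 else psi (p ω / μ ω) * μ ω) +
      ∑ ω, p ω * mA μ (consSection A ω) x := by
  refine le_of_forall_pos_le_add fun ε hε => ?_
  have hex : ∀ ω, ∃ ν : (Fin n → Ω) → ℝ, (∀ y, 0 ≤ ν y) ∧ (p ω ≠ 0 → ∑ y, ν y = 1 ∧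
      ∑ y ∈ consSection A ω, ν y = 1 ∧ mNu μ ν x < mA μ (consSection A ω) x + ε) := by
    intro ω
    by_cases h : p ω = 0
    · exact ⟨0, fun _ => le_rfl, fun h' => absurd h h'⟩
    · obtain ⟨ν, h0, h1⟩ := exists_mNu_lt (μ := μ) (hpA ω h) x hε
      exact ⟨ν, h0, fun _ => h1⟩
  choose ν hν0 hν using hex
  have hν1 : ∀ ω, p ω * ∑ y, ν ω y = p ω := fun ω => by
    by_cases h : p ω = 0
    · simp [h]
    · rw [(hν ω h).1, mul_one]
  have hνA : ∀ ω, p ω * ∑ y ∈ consSection A ω, ν ω y = p ω := fun ω => by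
    by_cases h : p ω = 0
    · simp [h]
    · rw [(hν ω h).2.1, mul_one]
  have hνm : ∀ ω, p ω * mNu μ (ν ω) x ≤ p ω * mA μ (consSection A ω) x + p ω * ε := fun ω => by
    by_cases h : p ω = 0
    · simp [h]
    · rw [← mul_add]
      exact mul_le_mul_of_nonneg_left (hν ω h).2.2.le (hp ω)
  set N : (Fin (n + 1) → Ω) → ℝ := fun z => p (z 0) * ν (z 0) (Fin.tail z) with hN
  have hNc : ∀ ω y, N (Fin.cons ω y) = p ω * ν ω y := fun ω y => by simp [hN]
  have hle : mA μ A (Fin.cons x₀ x) ≤ mNu μ N (Fin.cons x₀ x) := by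
    refine mA_le_mNu hμ _ (fun z => mul_nonneg (hp _) (hν0 _ _)) ?_ ?_
    · rw [sum_fin_succ_fun]
      simp only [hNc, ← mul_sum, hν1, hp1]
    · rw [sum_mem_eq_sum_consSection]
      simp only [hNc, ← mul_sum, hνA, hp1]
  refine hle.trans ?_
  have hzero : ∑ ω, psi ((∑ z ∈ univ.filter (fun z : Fin (n + 1) → Ω =>
      z 0 = ω ∧ z 0 ≠ (Fin.cons x₀ x : Fin (n + 1) → Ω) 0), N z) / μ ω) * μ ω =
      ∑ ω, (if ω = x₀ then 0 else psi (p ω / μ ω) * μ ω) := by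
    refine sum_congr rfl fun ω _ => ?_
    have e : ∑ z ∈ univ.filter (fun z : Fin (n + 1) → Ω =>
        z 0 = ω ∧ z 0 ≠ (Fin.cons x₀ x : Fin (n + 1) → Ω) 0), N z =
        if ω = x₀ then 0 else p ω := by
      rw [sum_filter, sum_fin_succ_fun, sum_eq_single ω]
      · simp only [Fin.cons_zero, hNc]
        by_cases h : ω = x₀
        · simp [h]
        · simp only [h, ne_eq, not_false_eq_true, and_self, if_true, if_false, ← mul_sum, hν1]
      · intro ω' _ h
        simp [h]
      · simp
    rw [e]
    split_ifs
    · rw [zero_div, psi_zero, zero_mul]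
    · rfl
  have hsucc : ∑ i : Fin n, ∑ ω, psi ((∑ z ∈ univ.filter (fun z : Fin (n + 1) → Ω =>
      z i.succ = ω ∧ z i.succ ≠ (Fin.cons x₀ x : Fin (n + 1) → Ω) i.succ), N z) / μ ω) * μ ω ≤
      ∑ ω, p ω * mNu μ (ν ω) x := by
    have e : ∑ ω, p ω * mNu μ (ν ω) x = ∑ i : Fin n, ∑ ω', (∑ ω, p ω *
        psi ((∑ y ∈ univ.filter (fun y : Fin n → Ω => y i = ω' ∧ y i ≠ x i), ν ω y) / μ ω')) *
          μ ω' := by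
      simp only [mNu, mul_sum, sum_mul, mul_assoc]
      rw [sum_comm]
      exact sum_congr rfl fun i _ => sum_comm
    rw [e]
    refine sum_le_sum fun i _ => sum_le_sum fun ω' _ => mul_le_mul_of_nonneg_right ?_ (hμ ω')
    refine le_trans (le_of_eq ?_) (psi_sum_le hp hp1 _)
    congr 1
    rw [sum_filter, sum_fin_succ_fun, sum_div]
    refine sum_congr rfl fun ω _ => ?_
    simp only [Fin.cons_succ, hNc]
    rw [← sum_filter, ← mul_sum, mul_div_assoc]
  have hfin : ∑ ω, p ω * mNu μ (ν ω) x ≤ ∑ ω, p ω * mA μ (consSection A ω) x + ε := by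
    refine (sum_le_sum fun ω _ => hνm ω).trans (le_of_eq ?_)
    rw [sum_add_distrib, ← sum_mul, hp1, one_mul]
  rw [mNu, Fin.sum_univ_succ, hzero]
  linarith

theorem sum_exp_mA_mul_le (hμ : ∀ ω, 0 < μ ω) (hμ1 : ∑ ω, μ ω = 1) (A : Finset (Fin n → Ω)) :
    (∑ x : Fin n → Ω, Real.exp (25 / 28 * mA μ A x) * ∏ i, μ (x i)) *
      ∑ x ∈ A, ∏ i, μ (x i) ≤ 1 := by
  have hμ0 := fun ω => (hμ ω).le
  induction n with
  | zero =>
    have hle : ∑ x ∈ A, ∏ i, μ (x i) ≤ 1 := by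
      refine (sum_le_sum_of_subset_of_nonneg (subset_univ A)
        fun x _ _ => prod_nonneg fun i _ => hμ0 _).trans ?_
      simp
    have hm : ∀ x, mA μ A x = 0 := fun x => by
      refine le_antisymm (Real.sInf_nonpos ?_) (mA_nonneg hμ0 A x)
      rintro r ⟨ν, -, -, -, rfl⟩
      simp [mNu]
    simpa [hm] using hle
  | succ n ih =>
    set f : Ω → ℝ := fun ω => ∑ y ∈ consSection A ω, ∏ i, μ (y i) with hf
    have hprod : ∀ ω (y : Fin n → Ω),
        ∏ i, μ ((Fin.cons ω y : Fin (n + 1) → Ω) i) = μ ω * ∏ i, μ (y i) := fun ω y => by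
      rw [Fin.prod_univ_succ]; simp
    have hPA : ∑ z ∈ A, ∏ i, μ (z i) = ∑ ω, μ ω * f ω := by
      rw [sum_mem_eq_sum_consSection]
      simp only [hprod, hf, mul_sum]
    have hf0 : ∀ ω, 0 ≤ f ω := fun ω => sum_nonneg fun y _ => prod_nonneg fun i _ => hμ0 _
    by_cases hex : ∃ ω, 0 < f ω
    swap
    · push Not at hex
      have hz : ∑ ω, μ ω * f ω = 0 :=
        sum_eq_zero fun ω _ => by rw [le_antisymm (hex ω) (hf0 ω), mul_zero]
      rw [hPA, hz, mul_zero]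
      exact zero_le_one
    obtain ⟨p, hp0, hp1, hpf, hp⟩ := exists_weights μ f hμ hμ1 hex
    refine le_trans ?_ hp
    rw [hPA]
    refine mul_le_mul_of_nonneg_right ?_ (sum_nonneg fun ω _ => mul_nonneg (hμ0 ω) (hf0 ω))
    rw [sum_fin_succ_fun]
    refine sum_le_sum fun ω _ => ?_
    set C := ∑ y, (if y = ω then 0 else psi (p ω y / μ y) * μ y) with hC
    have hne : ∀ y, p ω y ≠ 0 → (consSection A y).Nonempty := fun y hy => by
      by_contra hempty
      have := hpf ω y hy
      simp [hf, not_nonempty_iff_eq_empty.1 hempty] at this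
    have hpt : ∀ x : Fin n → Ω, Real.exp (25 / 28 * mA μ A (Fin.cons ω x)) ≤
        Real.exp (25 / 28 * C - ∑ y, p ω y * Real.log (f y)) *
          ∑ y, p ω y * (f y * Real.exp (25 / 28 * mA μ (consSection A y) x)) := fun x => by
      have h1 := mA_cons_le hμ0 A (hp0 ω) (hp1 ω) hne ω x
      have h2 := exp_sum_mul_le (m := fun y => 25 / 28 * mA μ (consSection A y) x)
        (hp0 ω) (hp1 ω) (hpf ω)
      have e : ∑ y, p ω y * (25 / 28 * mA μ (consSection A y) x) =
          25 / 28 * ∑ y, p ω y * mA μ (consSection A y) x := by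
        rw [mul_sum]; exact sum_congr rfl fun y _ => by ring
      rw [sub_eq_add_neg, Real.exp_add, mul_assoc]
      refine le_trans ?_ (mul_le_mul_of_nonneg_left h2 (Real.exp_pos _).le)
      rw [← Real.exp_add, e, ← mul_add]
      exact Real.exp_le_exp.2 (mul_le_mul_of_nonneg_left h1 (by norm_num))
    calc _ = μ ω * ∑ x : Fin n → Ω, Real.exp (25 / 28 * mA μ A (Fin.cons ω x)) *
            ∏ i, μ (x i) := by
          rw [mul_sum]
          refine sum_congr rfl fun x _ => ?_
          rw [hprod]; ring
      _ ≤ μ ω * ∑ x : Fin n → Ω, (Real.exp (25 / 28 * C - ∑ y, p ω y * Real.log (f y)) *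
            ∑ y, p ω y * (f y * Real.exp (25 / 28 * mA μ (consSection A y) x))) *
            ∏ i, μ (x i) :=
          mul_le_mul_of_nonneg_left (sum_le_sum fun x _ =>
            mul_le_mul_of_nonneg_right (hpt x) (prod_nonneg fun i _ => hμ0 _)) (hμ0 ω)
      _ = μ ω * (Real.exp (25 / 28 * C - ∑ y, p ω y * Real.log (f y)) *
            ∑ y, p ω y * ((∑ x : Fin n → Ω,
              Real.exp (25 / 28 * mA μ (consSection A y) x) * ∏ i, μ (x i)) * f y)) := by
          congr 1
          simp only [mul_sum, sum_mul]
          rw [sum_comm]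
          refine sum_congr rfl fun y _ => sum_congr rfl fun x _ => by ring
      _ ≤ _ := by
          refine mul_le_mul_of_nonneg_left ?_ (hμ0 ω)
          refine mul_le_of_le_one_right (Real.exp_pos _).le ?_
          rw [← hp1 ω]
          exact sum_le_sum fun y _ =>
            mul_le_of_le_one_right (hp0 ω y) (ih (consSection A y))

end tensorization

/-- Talagrand's concentration inequality (Theorem 1): for L ≥ 1.12 and any A ⊆ Ωⁿ with
P(A) > 0, ∫ exp((1/L) m(A,x)) dP(x) ≤ 1/P(A), where P = μⁿ. -/
theorem talagrand_concentration {Ω : Type*} [Fintype Ω] [DecidableEq Ω] [Nonempty Ω]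
    (μ : Ω → ℝ) (hμpos : ∀ ω, 0 < μ ω) (hμsum : ∑ ω, μ ω = 1)
    (n : ℕ) (hn : 1 ≤ n) (L : ℝ) (hL : 1.12 ≤ L)
    (A : Finset (Fin n → Ω)) (hA : 0 < ∑ x ∈ A, ∏ i, μ (x i)) :
    ∑ x : Fin n → Ω, Real.exp ((1 / L) * mA μ A x) * ∏ i, μ (x i) ≤
      1 / ∑ x ∈ A, ∏ i, μ (x i) := by
  have h := sum_exp_mA_mul_le hμpos hμsum A
  rw [← le_div_iff₀ hA] at h
  refine le_trans (sum_le_sum fun x _ => ?_) h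
  refine mul_le_mul_of_nonneg_right (Real.exp_le_exp.2 ?_) (prod_nonneg fun i _ => (hμpos _).le)
  refine mul_le_mul_of_nonneg_right ?_ (mA_nonneg (fun ω => (hμpos ω).le) A x)
  rw [div_le_iff₀ (by linarith)]
  linarith
end

section
/- Let L = 1.12 and let a ∈ ℝ be such that P(Z ≤ a) > 0. Then for every u > 0, P( { x : Z(x) > a + 2·max( L·u, σ·√(L·u) ) } ) ≤ e^{−u} / P(Z ≤ a). -/
open Finset

/-- A quadratic bound for `2 cosh D` on a bounded interval. -/
lemma exp_add_exp_neg_le {D : ℝ} (hD : |D| ≤ 1 / 1.12) :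
    Real.exp D + Real.exp (-D) ≤ 2 + 1.12 * D ^ 2 := by
  have h1 : |D| ≤ 1 := hD.trans (by norm_num)
  have e1 := (abs_le.1 (Real.exp_bound h1 (n := 4) (by norm_num))).2
  have e2 := (abs_le.1 (Real.exp_bound (x := -D) (by simpa using h1) (n := 4) (by norm_num))).2
  have h4 : |D| ^ 4 = D ^ 2 * D ^ 2 := by rw [← sq_abs D]; ring
  have h2 : D ^ 2 ≤ (1 / 1.12) ^ 2 := by
    rw [← sq_abs]; gcongr
  simp only [abs_neg, h4, Finset.sum_range_succ, Finset.sum_range_zero, Nat.factorial] at e1 e2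
  norm_num at e1 e2 h2
  nlinarith [sq_nonneg D, mul_le_mul_of_nonneg_left h2 (sq_nonneg D)]

section OneCoordinate

variable {Ω : Type*} [Fintype Ω]

/-- The one-coordinate exponential inequality: the product of the Laplace transforms of
`g - L · E (g - g')₊²` and of `-g` is at most one when `g` has small oscillation. -/
lemma sum_exp_mul_sum_exp_neg_le_one (μ : Ω → ℝ) (hμ : ∀ ω, 0 ≤ μ ω) (hμsum : ∑ ω, μ ω = 1)
    {L : ℝ} (hL : 0 ≤ L) (g : Ω → ℝ)
    (hg : ∀ x y, Real.exp (g x - g y) + Real.exp (-(g x - g y)) ≤ 2 + L * (g x - g y) ^ 2) :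
    (∑ x, μ x * Real.exp (g x - L * ∑ y, μ y * (max (g x - g y) 0) ^ 2)) *
      (∑ y, μ y * Real.exp (-g y)) ≤ 1 := by
  set q : Ω → ℝ := fun x => ∑ y, μ y * (max (g x - g y) 0) ^ 2 with hq
  set v : Ω → ℝ := fun x => Real.exp (-(L * q x)) with hv
  have hv0 : ∀ x, 0 ≤ v x := fun x => (Real.exp_pos _).le
  have hanti : ∀ x y, g y ≤ g x → v x ≤ v y := by
    intro x y hxy
    apply Real.exp_le_exp.2
    apply neg_le_neg
    apply mul_le_mul_of_nonneg_left _ hL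
    apply Finset.sum_le_sum
    intro z _
    apply mul_le_mul_of_nonneg_left _ (hμ z)
    gcongr
  set A : Ω → Ω → ℝ := fun x y => v x * Real.exp (g x - g y) with hA
  set B : Ω → Ω → ℝ := fun x y => v x * (1 + L * (max (g x - g y) 0) ^ 2) with hB
  have key : ∀ x y, g y ≤ g x → A x y + A y x ≤ B x y + B y x := by
    intro x y hxy
    have h1 : Real.exp (g y - g x) ≤ 1 := Real.exp_le_one_iff.2 (by linarith)
    have h2 := hg x y
    have h3 := hanti x y hxy
    have h4 : -(g x - g y) = g y - g x := by ring
    rw [h4] at h2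
    simp only [hA, hB, max_eq_left (sub_nonneg.2 hxy), max_eq_right (sub_nonpos.2 hxy)]
    nlinarith [mul_le_mul_of_nonneg_left h2 (hv0 x),
      mul_le_mul_of_nonneg_left h1 (sub_nonneg.2 h3)]
  have key' : ∀ x y, A x y + A y x ≤ B x y + B y x := by
    intro x y
    rcases le_total (g y) (g x) with h | h
    · exact key x y h
    · linarith [key y x h]
  have swap : ∀ C : Ω → Ω → ℝ, 2 * ∑ x, ∑ y, μ x * μ y * C x y =
      ∑ x, ∑ y, μ x * μ y * (C x y + C y x) := by
    intro C
    have : ∑ x, ∑ y, μ x * μ y * C x y = ∑ x, ∑ y, μ x * μ y * C y x := by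
      rw [Finset.sum_comm]
      exact Finset.sum_congr rfl fun x _ => Finset.sum_congr rfl fun y _ => by ring
    simp only [mul_add, Finset.sum_add_distrib]
    linarith
  have hAB : ∑ x, ∑ y, μ x * μ y * A x y ≤ ∑ x, ∑ y, μ x * μ y * B x y := by
    have : ∑ x, ∑ y, μ x * μ y * (A x y + A y x) ≤ ∑ x, ∑ y, μ x * μ y * (B x y + B y x) := by
      refine Finset.sum_le_sum fun x _ => Finset.sum_le_sum fun y _ => ?_
      exact mul_le_mul_of_nonneg_left (key' x y) (mul_nonneg (hμ x) (hμ y))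
    rw [← swap, ← swap] at this
    linarith
  have hAeq : (∑ x, μ x * Real.exp (g x - L * q x)) * (∑ y, μ y * Real.exp (-g y)) =
      ∑ x, ∑ y, μ x * μ y * A x y := by
    rw [Finset.sum_mul_sum]
    refine Finset.sum_congr rfl fun x _ => Finset.sum_congr rfl fun y _ => ?_
    have : v x * Real.exp (g x - g y) = Real.exp (g x - L * q x) * Real.exp (-g y) := by
      simp only [hv, ← Real.exp_add]
      congr 1; ring
    simp only [hA, this]; ring
  have hBeq : ∑ x, ∑ y, μ x * μ y * B x y = ∑ x, μ x * (v x * (1 + L * q x)) := by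
    refine Finset.sum_congr rfl fun x _ => ?_
    have : ∑ y, μ x * μ y * B x y =
        μ x * (v x * ((∑ y, μ y) + L * q x)) := by
      simp only [hB, hq, Finset.mul_sum, ← Finset.sum_add_distrib]
      exact Finset.sum_congr rfl fun y _ => by ring
    rw [this, hμsum]
  rw [hAeq]
  refine hAB.trans (hBeq.trans_le ?_)
  refine le_trans (Finset.sum_le_sum fun x _ => ?_) hμsum.le
  refine mul_le_of_le_one_right (hμ x) ?_
  have h1 : 1 + L * q x ≤ Real.exp (L * q x) := by linarith [Real.add_one_le_exp (L * q x)]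
  calc v x * (1 + L * q x) ≤ v x * Real.exp (L * q x) := mul_le_mul_of_nonneg_left h1 (hv0 x)
    _ = 1 := by simp only [hv, ← Real.exp_add]; simp

/-- The water-filling level: either the mass `2 L E (l - g)₊` equals one, or the level `l` reaches
`g y₀ + t`. -/
lemma exists_level_s12 (μ : Ω → ℝ) (L t : ℝ) (ht : 0 ≤ t) (g : Ω → ℝ) (y₀ : Ω)
    (hy₀ : ∀ y, g y₀ ≤ g y) :
    ∃ l, g y₀ ≤ l ∧ l ≤ g y₀ + t ∧ ∑ y, μ y * (2 * L * max (l - g y) 0) ≤ 1 ∧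
      (1 - ∑ y, μ y * (2 * L * max (l - g y) 0)) * (g y₀ + t - l) = 0 := by
  set M : ℝ → ℝ := fun l => ∑ y, μ y * (2 * L * max (l - g y) 0) with hM
  have hcont : Continuous M := by fun_prop
  have hM0 : M (g y₀) = 0 := by
    refine Finset.sum_eq_zero fun y _ => ?_
    rw [max_eq_right (sub_nonpos.2 (hy₀ y))]; ring
  by_cases h : M (g y₀ + t) ≤ 1
  · exact ⟨g y₀ + t, by linarith, le_rfl, h, by ring⟩
  · obtain ⟨l, hl, hl1⟩ := intermediate_value_Icc (by linarith : g y₀ ≤ g y₀ + t)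
      hcont.continuousOn (show (1 : ℝ) ∈ Set.Icc (M (g y₀)) (M (g y₀ + t)) from
        ⟨by rw [hM0]; norm_num, (not_le.1 h).le⟩)
    refine ⟨l, hl.1, hl.2, hl1.le, ?_⟩
    change (1 - M l) * _ = 0
    rw [hl1]; ring

/-- Splitting off the first coordinate of a sum against a product measure. -/
lemma sum_prod_cons (μ : Ω → ℝ) (n : ℕ) (φ : (Fin (n + 1) → Ω) → ℝ) :
    ∑ x, (∏ i, μ (x i)) * φ x =
      ∑ ω, μ ω * ∑ x : Fin n → Ω, (∏ i, μ (x i)) * φ (Fin.cons ω x) := by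
  rw [← (Fin.consEquiv fun _ : Fin (n + 1) => Ω).sum_comp, Fintype.sum_prod_type]
  refine Finset.sum_congr rfl fun ω _ => ?_
  rw [Finset.mul_sum]
  refine Finset.sum_congr rfl fun x _ => ?_
  simp [Fin.consEquiv, Fin.prod_univ_succ, mul_assoc]

variable [DecidableEq Ω] [Nonempty Ω]

/-- Existence of the one-coordinate kernel `ν`. -/
lemma exists_kernel (μ : Ω → ℝ) (hμ : ∀ ω, 0 ≤ μ ω) (hμsum : ∑ ω, μ ω = 1)
    {L α : ℝ} (hL : 0 < L) (hα : 0 < α) (hα1 : α ≤ 1)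
    (hexp : ∀ D : ℝ, |D| ≤ 1 / L → Real.exp D + Real.exp (-D) ≤ 2 + L * D ^ 2)
    (g : Ω → ℝ) :
    ∃ (ν : Ω → Ω → ℝ) (h : Ω → ℝ), (∀ x y, 0 ≤ ν x y) ∧ (∀ x, ∑ y, ν x y = 1) ∧
      (∑ x, μ x * Real.exp (h x)) * (∑ y, μ y * Real.exp (-g y)) ≤ 1 ∧
      ∀ x, ∀ f : Ω → ℝ, (∀ ω, f ω ∈ Set.Icc (0 : ℝ) 1) →
        ∑ y, ν x y * (g y + α / L * (if y = x then 0 else f y)) -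
          α / L * α * ∑ ω, f ω ^ 2 * μ ω ≤ h x := by
  obtain ⟨y₀, hy₀⟩ := Finite.exists_min g
  have ht0 : 0 < α / L := div_pos hα hL
  obtain ⟨l, hl0, hlt, hmass, hslack⟩ := exists_level_s12 μ L (α / L) ht0.le g y₀ hy₀
  set t := α / L with ht
  set s : Ω → ℝ := fun x => min (g x) l with hs
  set d : Ω → Ω → ℝ := fun x y => 2 * L * max (s x - g y) 0 with hd
  set r : Ω → ℝ := fun x => 1 - ∑ y, μ y * d x y with hr
  set z : Ω → Ω := fun x => if g x ≤ l then x else y₀ with hz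
  have hd0 : ∀ x y, 0 ≤ d x y := fun x y => by positivity
  have hr0 : ∀ x, 0 ≤ r x := by
    intro x
    have : ∑ y, μ y * d x y ≤ ∑ y, μ y * (2 * L * max (l - g y) 0) := by
      refine Finset.sum_le_sum fun y _ => mul_le_mul_of_nonneg_left ?_ (hμ y)
      have : s x ≤ l := min_le_right _ _
      simp only [hd]; gcongr
    simp only [hr]; linarith
  refine ⟨fun x y => μ y * d x y + if y = z x then r x else 0,
    fun x => s x - L * ∑ y, μ y * (max (s x - g y) 0) ^ 2, ?_, ?_, ?_, ?_⟩
  · intro x y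
    have := mul_nonneg (hμ y) (hd0 x y)
    have := hr0 x
    positivity
  · intro x
    rw [Finset.sum_add_distrib, Finset.sum_ite_eq' univ (z x)]
    simp [hr]
  · have hq : ∀ x y, max (s x - g y) 0 = max (s x - s y) 0 := by
      intro x y
      rcases le_total (g y) l with h | h
      · simp [hs, h]
      · have h1 : s x ≤ l := min_le_right _ _
        have h2 : s y = l := min_eq_right h
        rw [h2, max_eq_right (by linarith), max_eq_right (by linarith)]
    have hbd : ∀ x, g y₀ ≤ s x ∧ s x ≤ g y₀ + t := fun x =>
      ⟨le_min (hy₀ x) hl0, (min_le_right _ _).trans hlt⟩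
    have ht1 : t ≤ 1 / L := by rw [ht]; gcongr
    have hmain := sum_exp_mul_sum_exp_neg_le_one μ hμ hμsum hL.le s (fun x y => hexp _ (by
      rw [abs_le]
      constructor <;> linarith [(hbd x).1, (hbd x).2, (hbd y).1, (hbd y).2]))
    simp only [hq]
    refine le_trans ?_ hmain
    refine mul_le_mul_of_nonneg_left ?_
      (Finset.sum_nonneg fun x _ => mul_nonneg (hμ x) (Real.exp_pos _).le)
    refine Finset.sum_le_sum fun y _ => mul_le_mul_of_nonneg_left ?_ (hμ y)
    exact Real.exp_le_exp.2 (neg_le_neg (min_le_left _ _))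
  · intro x f hf
    have hpoint : ∀ y, μ y * d x y * (g y + t * (if y = x then 0 else f y)) -
        t * α * (f y ^ 2 * μ y) ≤
        s x * (μ y * d x y) - L * (μ y * (max (s x - g y) 0) ^ 2) := by
      intro y
      have hw : ∀ w : ℝ, w = max (s x - g y) 0 →
          w * (s x - g y) = w ^ 2 := by
        rintro w rfl
        rcases le_total (s x - g y) 0 with h | h
        · simp [max_eq_right h]
        · rw [max_eq_left h]; ring
      set w := max (s x - g y) 0 with hwdef
      have hw0 : 0 ≤ w := le_max_right _ _
      have hw2 := hw w rfl
      have hif : (if y = x then 0 else f y) ≤ f y := by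
        split_ifs
        · exact (hf y).1
        · exact le_rfl
      have htL : t * L = α := by rw [ht]; field_simp
      have hyoung : d x y * (t * (if y = x then 0 else f y)) - t * α * f y ^ 2 ≤ L * w ^ 2 := by
        have h1 : d x y * (t * (if y = x then 0 else f y)) ≤ d x y * (t * f y) := by
          have := hd0 x y
          gcongr
        have h2 : d x y * (t * f y) = 2 * α * w * f y := by
          simp only [hd, ← hwdef, ← htL]; ring
        have h3 : t * α * f y ^ 2 = L * (t * f y) ^ 2 := by rw [← htL]; ring
        have h4 : 2 * α * w * f y = 2 * L * (w * (t * f y)) := by rw [← htL]; ring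
        rw [h2, h4] at h1
        rw [h3]
        nlinarith [mul_nonneg hL.le (sq_nonneg (w - t * f y))]
      have hdg : d x y * g y = s x * d x y - 2 * L * w ^ 2 := by
        simp only [hd, ← hwdef]; linear_combination (-2 * L) * hw2
      have := mul_le_mul_of_nonneg_left hyoung (hμ y)
      linear_combination this + μ y * hdg
    have hsum := Finset.sum_le_sum fun y (_ : y ∈ univ) => hpoint y
    have hres : r x * (g (z x) + t * (if z x = x then 0 else f (z x))) ≤ r x * s x := by
      by_cases h : g x ≤ l
      · simp [hz, hs, h]
      · have hsx : s x = l := min_eq_right (not_le.1 h).le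
        have hzx : z x = y₀ := by simp [hz, h]
        have hrx : r x * (g y₀ + t - l) = 0 := by
          simpa only [hr, hd, hsx] using hslack
        have hif : (if y₀ = x then 0 else f y₀) ≤ 1 := by
          split_ifs
          · norm_num
          · exact (hf y₀).2
        rw [hsx, hzx]
        have h1 : r x * (g y₀ + t * (if y₀ = x then 0 else f y₀)) ≤ r x * (g y₀ + t * 1) := by
          have := hr0 x
          gcongr
        linarith
    simp only [Finset.sum_sub_distrib, ← Finset.mul_sum] at hsum
    have hsplit : ∑ y, (μ y * d x y + if y = z x then r x else 0) *
        (g y + t * (if y = x then 0 else f y)) =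
        ∑ y, μ y * d x y * (g y + t * (if y = x then 0 else f y)) +
          r x * (g (z x) + t * (if z x = x then 0 else f (z x))) := by
      simp only [add_mul _ _ (g _ + _), Finset.sum_add_distrib]
      congr 1
      simp only [ite_mul, zero_mul]
      rw [Finset.sum_ite_eq' univ (z x)]
      simp
    rw [hsplit]
    have : s x * r x = s x - s x * ∑ y, μ y * d x y := by simp only [hr]; ring
    linarith

/-- Tensorization of the one-coordinate kernel inequality. -/
lemma exists_product_penalty (μ : Ω → ℝ) (hμ : ∀ ω, 0 < μ ω) (hμsum : ∑ ω, μ ω = 1)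
    {L α : ℝ} (hL : 0 < L) (hα : 0 < α) (hα1 : α ≤ 1)
    (hexp : ∀ D : ℝ, |D| ≤ 1 / L → Real.exp D + Real.exp (-D) ≤ 2 + L * D ^ 2)
    (n : ℕ) (g : (Fin n → Ω) → ℝ) :
    ∃ h : (Fin n → Ω) → ℝ,
      (∑ x, (∏ i, μ (x i)) * Real.exp (h x)) * (∑ y, (∏ i, μ (y i)) * Real.exp (-g y)) ≤ 1 ∧
      ∀ x, ∀ f : Ω → ℝ, (∀ ω, f ω ∈ Set.Icc (0 : ℝ) 1) → ∃ y,
        g y + α / L * (∑ i, if y i = x i then 0 else f (y i)) -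
          n * (α / L * α * ∑ ω, f ω ^ 2 * μ ω) ≤ h x := by
  induction n with
  | zero =>
    refine ⟨g, ?_, fun x f _ => ⟨x, by simp⟩⟩
    simp [← Real.exp_add]
  | succ n ih =>
    choose h hh hf using fun ω => ih (fun x => g (Fin.cons ω x))
    set E : Ω → ℝ := fun ω => ∑ y : Fin n → Ω, (∏ i, μ (y i)) * Real.exp (-g (Fin.cons ω y)) with hE
    have hEpos : ∀ ω, 0 < E ω := fun ω =>
      Finset.sum_pos (fun y _ => mul_pos (Finset.prod_pos fun i _ => hμ _) (Real.exp_pos _))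
        univ_nonempty
    set G : Ω → ℝ := fun ω => -Real.log (E ω) with hG
    have hGexp : ∀ ω, Real.exp (-G ω) = E ω := fun ω => by
      simp only [hG, neg_neg, Real.exp_log (hEpos ω)]
    obtain ⟨ν, k, hν0, hν1, hk, hkf⟩ :=
      exists_kernel μ (fun ω => (hμ ω).le) hμsum hL hα hα1 hexp G
    refine ⟨fun x => k (x 0) + ∑ ω, ν (x 0) ω * (h ω (Fin.tail x) - G ω), ?_, ?_⟩
    · rw [sum_prod_cons, sum_prod_cons]
      have hEsum : ∑ ω, μ ω * ∑ y : Fin n → Ω, (∏ i, μ (y i)) * Real.exp (-g (Fin.cons ω y)) =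
          ∑ ω, μ ω * Real.exp (-G ω) := by simp only [hGexp, hE]
      rw [hEsum]
      refine le_trans (mul_le_mul_of_nonneg_right ?_ ?_) hk
      · refine Finset.sum_le_sum fun ω _ => mul_le_mul_of_nonneg_left ?_ (hμ ω).le
        simp only [Fin.cons_zero, Fin.tail_cons]
        have jensen : ∀ x : Fin n → Ω, Real.exp (∑ ω', ν ω ω' * (h ω' x - G ω')) ≤
            ∑ ω', ν ω ω' * Real.exp (h ω' x - G ω') := fun x => by
          simpa using convexOn_exp.map_sum_le (t := univ) (w := ν ω)
            (p := fun ω' => h ω' x - G ω') (fun i _ => hν0 ω i) (hν1 ω) (fun _ _ => Set.mem_univ _)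
        calc ∑ x : Fin n → Ω, (∏ i, μ (x i)) *
              Real.exp (k ω + ∑ ω', ν ω ω' * (h ω' x - G ω'))
            ≤ ∑ x : Fin n → Ω, (∏ i, μ (x i)) *
              (Real.exp (k ω) * ∑ ω', ν ω ω' * Real.exp (h ω' x - G ω')) := by
              refine Finset.sum_le_sum fun x _ => mul_le_mul_of_nonneg_left ?_
                (Finset.prod_nonneg fun i _ => (hμ _).le)
              rw [Real.exp_add]
              exact mul_le_mul_of_nonneg_left (jensen x) (Real.exp_pos _).le
          _ = Real.exp (k ω) * ∑ ω', ν ω ω' *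
              ((∑ x : Fin n → Ω, (∏ i, μ (x i)) * Real.exp (h ω' x)) * E ω') := by
              simp only [Finset.mul_sum, Finset.sum_mul]
              rw [Finset.sum_comm]
              refine Finset.sum_congr rfl fun ω' _ => Finset.sum_congr rfl fun x _ => ?_
              rw [sub_eq_add_neg, Real.exp_add, hGexp]; ring
          _ ≤ Real.exp (k ω) * ∑ ω', ν ω ω' * 1 := by
              refine mul_le_mul_of_nonneg_left ?_ (Real.exp_pos _).le
              exact Finset.sum_le_sum fun ω' _ => mul_le_mul_of_nonneg_left (hh ω') (hν0 ω ω')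
          _ = Real.exp (k ω) := by simp [hν1]
      · exact Finset.sum_nonneg fun ω _ => mul_nonneg (hμ ω).le (Real.exp_pos _).le
    · intro x f hf01
      choose y hy using fun ω => hf ω (Fin.tail x) f hf01
      have h1 := hkf (x 0) f hf01
      set V := α / L * α * ∑ ω, f ω ^ 2 * μ ω
      set c : Ω → ℝ := fun ω => α / L * (if ω = x 0 then 0 else f ω) with hc
      by_contra! hcon
      have hlow : ∀ ω, k (x 0) + ∑ ω, ν (x 0) ω * (h ω (Fin.tail x) - G ω) <
          h ω (Fin.tail x) + c ω - V := by
        intro ω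
        have h2 := hy ω
        have h3 := hcon (Fin.cons ω (y ω))
        rw [Fin.sum_univ_succ] at h3
        simp only [Fin.cons_zero, Fin.cons_succ, Nat.cast_add, Nat.cast_one] at h3
        have h4 : ∑ i, (if y ω i = x i.succ then 0 else f (y ω i)) =
            ∑ i, if y ω i = Fin.tail x i then 0 else f (y ω i) := rfl
        rw [h4] at h3
        simp only [hc]
        linarith
      have hstrict : ∑ ω, ν (x 0) ω *
            (k (x 0) + ∑ ω, ν (x 0) ω * (h ω (Fin.tail x) - G ω)) <
          ∑ ω, ν (x 0) ω * (h ω (Fin.tail x) + c ω - V) := by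
        obtain ⟨ω, hω⟩ : ∃ ω, 0 < ν (x 0) ω := by
          by_contra! hneg
          have := Finset.sum_nonpos fun ω (_ : ω ∈ univ) => hneg ω
          rw [hν1] at this
          norm_num at this
        exact Finset.sum_lt_sum
          (fun ω _ => mul_le_mul_of_nonneg_left (hlow ω).le (hν0 _ _))
          ⟨ω, mem_univ ω, mul_lt_mul_of_pos_left (hlow ω) hω⟩
      rw [← Finset.sum_mul, hν1] at hstrict
      simp only [mul_add, mul_sub, Finset.sum_add_distrib, Finset.sum_sub_distrib,
        ← Finset.sum_mul, hν1] at hstrict h1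
      simp only [hc] at hstrict
      linarith

/-- The deviation bound for a fixed truncation parameter `α`. -/
lemma deviation_of_parameter (μ : Ω → ℝ) (hμ : ∀ ω, 0 < μ ω) (hμsum : ∑ ω, μ ω = 1)
    {L α : ℝ} (hL : 0 < L) (hα : 0 < α) (hα1 : α ≤ 1)
    (hexp : ∀ D : ℝ, |D| ≤ 1 / L → Real.exp D + Real.exp (-D) ≤ 2 + L * D ^ 2)
    (n : ℕ) (F : Finset (Ω → ℝ)) (hF : F.Nonempty)
    (hrange : ∀ f ∈ F, ∀ ω, f ω ∈ Set.Icc (0 : ℝ) 1)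
    (Z : (Fin n → Ω) → ℝ)
    (hZ : ∀ x, Z x = F.sup' hF (fun f => ∑ i : Fin n, ((∑ ω, f ω * μ ω) - f (x i))))
    (v : ℝ) (hv : ∀ f ∈ F, n * ∑ ω, f ω ^ 2 * μ ω ≤ v)
    (a : ℝ) (ha : 0 < ∑ x ∈ univ.filter (fun x : Fin n → Ω => Z x ≤ a), ∏ i, μ (x i))
    (u r : ℝ) (hr : u ≤ α / L * (r - α * v)) :
    ∑ x ∈ univ.filter (fun x : Fin n → Ω => a + r < Z x), ∏ i, μ (x i) ≤
    Real.exp (-u) / ∑ x ∈ univ.filter (fun x : Fin n → Ω => Z x ≤ a), ∏ i, μ (x i) := by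
  have ht : 0 < α / L := div_pos hα hL
  obtain ⟨h, hh, hx⟩ := exists_product_penalty μ hμ hμsum hL hα hα1 hexp n
    (fun y => if Z y ≤ a then 0 else u + α / L * α * v)
  have hP : ∀ x : Fin n → Ω, 0 ≤ ∏ i, μ (x i) := fun x => Finset.prod_nonneg fun i _ => (hμ _).le
  have hu : ∀ x, a + r < Z x → u ≤ h x := by
    intro x hxZ
    obtain ⟨f, hfF, hf⟩ := F.exists_mem_eq_sup' hF
      (fun f => ∑ i : Fin n, ((∑ ω, f ω * μ ω) - f (x i)))
    rw [← hZ] at hf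
    obtain ⟨y, hy⟩ := hx x f (hrange f hfF)
    have hvf : α / L * α * (n * ∑ ω, f ω ^ 2 * μ ω) ≤ α / L * α * v :=
      mul_le_mul_of_nonneg_left (hv f hfF) (by positivity)
    by_cases hya : Z y ≤ a
    · simp only [hya, if_true] at hy
      have hZy : ∑ i : Fin n, ((∑ ω, f ω * μ ω) - f (y i)) ≤ a :=
        (Finset.le_sup' (fun f : Ω → ℝ => ∑ i : Fin n, ((∑ ω, f ω * μ ω) - f (y i))) hfF).trans
          ((hZ y).symm.le.trans hya)
      have hdiff : Z x - a ≤ ∑ i, if y i = x i then 0 else f (y i) := by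
        have : ∑ i : Fin n, ((∑ ω, f ω * μ ω) - f (x i)) -
            ∑ i : Fin n, ((∑ ω, f ω * μ ω) - f (y i)) ≤
            ∑ i, if y i = x i then 0 else f (y i) := by
          rw [← Finset.sum_sub_distrib]
          refine Finset.sum_le_sum fun i _ => ?_
          split_ifs with hi
          · rw [hi]; linarith
          · linarith [(hrange f hfF (x i)).1]
        linarith
      have := mul_le_mul_of_nonneg_left (show r ≤ ∑ i, if y i = x i then 0 else f (y i) by
        linarith) ht.le
      linarith
    · simp only [hya, if_false] at hy
      have : 0 ≤ α / L * ∑ i, if y i = x i then 0 else f (y i) := by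
        refine mul_nonneg ht.le (Finset.sum_nonneg fun i _ => ?_)
        split_ifs
        · exact le_rfl
        · exact (hrange f hfF _).1
      linarith
  have hA : ∑ x ∈ univ.filter (fun x : Fin n → Ω => Z x ≤ a), ∏ i, μ (x i) ≤
      ∑ y : Fin n → Ω, (∏ i, μ (y i)) *
        Real.exp (-(if Z y ≤ a then 0 else u + α / L * α * v)) := by
    rw [Finset.sum_filter]
    refine Finset.sum_le_sum fun y _ => ?_
    split_ifs
    · simp
    · exact mul_nonneg (hP y) (Real.exp_pos _).le
  have hB : Real.exp u * ∑ x ∈ univ.filter (fun x : Fin n → Ω => a + r < Z x), ∏ i, μ (x i) ≤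
      ∑ x : Fin n → Ω, (∏ i, μ (x i)) * Real.exp (h x) := by
    rw [Finset.sum_filter, Finset.mul_sum]
    refine Finset.sum_le_sum fun x _ => ?_
    split_ifs with hxZ
    · rw [mul_comm]
      exact mul_le_mul_of_nonneg_left (Real.exp_le_exp.2 (hu x hxZ)) (hP x)
    · rw [mul_zero]
      exact mul_nonneg (hP x) (Real.exp_pos _).le
  rw [le_div_iff₀ ha, Real.exp_neg, ← one_div, le_div_iff₀ (Real.exp_pos u)]
  have := mul_le_mul hB hA ha.le
    (Finset.sum_nonneg fun x _ => mul_nonneg (hP x) (Real.exp_pos _).le)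
  linarith

end OneCoordinate

/-- For L = 1.12 and P(Z ≤ a) > 0, for every u > 0,
P(Z > a + 2 max(Lu, σ√(Lu))) ≤ e^{−u}/P(Z ≤ a). -/
theorem deviation_above_level {Ω : Type*} [Fintype Ω] [DecidableEq Ω] [Nonempty Ω]
    (μ : Ω → ℝ) (hμpos : ∀ ω, 0 < μ ω) (hμsum : ∑ ω, μ ω = 1)
    (n : ℕ) (F : Finset (Ω → ℝ)) (hF : F.Nonempty)
    (hrange : ∀ f ∈ F, ∀ ω, f ω ∈ Set.Icc (0 : ℝ) 1)
    (Z : (Fin n → Ω) → ℝ)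
    (hZ : ∀ x, Z x = F.sup' hF (fun f => ∑ i : Fin n, ((∑ ω, f ω * μ ω) - f (x i))))
    (σ : ℝ) (hσ : σ = Real.sqrt (n * F.sup' hF (fun f => ∑ ω, f ω ^ 2 * μ ω)))
    (L : ℝ) (hL : L = 1.12)
    (a : ℝ) (ha : 0 < ∑ x ∈ univ.filter (fun x : Fin n → Ω => Z x ≤ a), ∏ i, μ (x i))
    (u : ℝ) (hu : 0 < u) :
    ∑ x ∈ univ.filter
        (fun x : Fin n → Ω => a + 2 * max (L * u) (σ * Real.sqrt (L * u)) < Z x),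
      ∏ i, μ (x i) ≤
    Real.exp (-u) / ∑ x ∈ univ.filter (fun x : Fin n → Ω => Z x ≤ a), ∏ i, μ (x i) := by
  have hL0 : 0 < L := by rw [hL]; norm_num
  have hexp : ∀ D : ℝ, |D| ≤ 1 / L → Real.exp D + Real.exp (-D) ≤ 2 + L * D ^ 2 := by
    subst hL
    exact fun D hD => exp_add_exp_neg_le hD
  have hLu : 0 < L * u := mul_pos hL0 hu
  have hsup : 0 ≤ F.sup' hF (fun f => ∑ ω, f ω ^ 2 * μ ω) := by
    obtain ⟨f, hf⟩ := hF
    exact (Finset.sum_nonneg fun ω _ => mul_nonneg (sq_nonneg (f ω)) (hμpos ω).le).trans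
      (Finset.le_sup' (fun f : Ω → ℝ => ∑ ω, f ω ^ 2 * μ ω) hf)
  have hσ0 : 0 ≤ σ := hσ ▸ Real.sqrt_nonneg _
  have hσ2 : σ ^ 2 = n * F.sup' hF (fun f => ∑ ω, f ω ^ 2 * μ ω) := by
    rw [hσ, Real.sq_sqrt (by positivity)]
  have hv : ∀ f ∈ F, n * ∑ ω, f ω ^ 2 * μ ω ≤ σ ^ 2 := by
    intro f hf
    rw [hσ2]
    exact mul_le_mul_of_nonneg_left
      (Finset.le_sup' (fun f : Ω → ℝ => ∑ ω, f ω ^ 2 * μ ω) hf) (Nat.cast_nonneg n)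
  set w := Real.sqrt (L * u) with hw
  have hw0 : 0 < w := Real.sqrt_pos.2 hLu
  have hw2 : w ^ 2 = L * u := Real.sq_sqrt hLu.le
  rcases le_total w σ with hcase | hcase
  · have hσpos : 0 < σ := hw0.trans_le hcase
    refine deviation_of_parameter μ hμpos hμsum hL0 (div_pos hw0 hσpos)
      ((div_le_one hσpos).2 hcase) hexp n F hF hrange Z hZ (σ ^ 2) hv a ha u _ ?_
    have h1 : u = w / σ / L * (2 * (σ * w) - w / σ * σ ^ 2) := by
      field_simp
      linarith
    have h2 : σ * w ≤ max (L * u) (σ * w) := le_max_right _ _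
    have h3 : 0 ≤ w / σ / L := by positivity
    refine h1.le.trans (mul_le_mul_of_nonneg_left ?_ h3)
    linarith
  · refine deviation_of_parameter μ hμpos hμsum hL0 one_pos le_rfl hexp n F hF hrange Z hZ
      (σ ^ 2) hv a ha u _ ?_
    have h1 : σ ^ 2 ≤ L * u := hw2 ▸ pow_le_pow_left₀ hσ0 hcase 2
    have h2 : L * u ≤ max (L * u) (σ * w) := le_max_left _ _
    rw [div_mul_eq_mul_div, le_div_iff₀ hL0]
    linarith
end

section
/- Let L = 1.12 and let M be a median of Z under P. Then for every u > 0, P( Z ≥ M + 2·max( L·u, σ·√(L·u) ) ) ≤ 2·e^{−u}. -/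
open Finset

/-- If `e ^ b + e ^ (-b) - 2 ≤ L b²` on the range of the oscillation of `v`, then an average of
`e ^ v` is compensated by the quadratic penalty for moving upwards. -/
lemma sum_exp_neg_sub_mul_sum_exp_le_one {Ω : Type*} [Fintype Ω] {μ : Ω → ℝ}
    (hμ : ∀ ω, 0 ≤ μ ω) (hsum : ∑ ω, μ ω = 1) {L : ℝ} (hL : 0 ≤ L) (v : Ω → ℝ)
    (hv : ∀ x y, Real.exp (v y - v x) + Real.exp (v x - v y) - 2 ≤ L * (v y - v x) ^ 2) :
    (∑ x, μ x * Real.exp (-v x - L * ∑ y, μ y * max (v y - v x) 0 ^ 2)) *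
      ∑ y, μ y * Real.exp (v y) ≤ 1 := by
  set J : Ω → ℝ := fun x => L * ∑ y, μ y * max (v y - v x) 0 ^ 2 with hJ
  have hJanti : ∀ x y, v x ≤ v y → J y ≤ J x := by
    intro x y hxy
    refine mul_le_mul_of_nonneg_left (sum_le_sum fun z _ => ?_) hL
    gcongr
    exact hμ z
  have hpair : ∀ x y, v x ≤ v y →
      Real.exp (v y - v x) * Real.exp (-J x) + Real.exp (v x - v y) * Real.exp (-J y) ≤
        Real.exp (-J x) * (1 + L * max (v y - v x) 0 ^ 2) +
          Real.exp (-J y) * (1 + L * max (v x - v y) 0 ^ 2) := by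
    intro x y hxy
    rw [max_eq_left (sub_nonneg.2 hxy), max_eq_right (sub_nonpos.2 hxy)]
    have h1 : Real.exp (-J x) ≤ Real.exp (-J y) :=
      Real.exp_le_exp.2 (neg_le_neg (hJanti x y hxy))
    have h2 : Real.exp (v x - v y) ≤ 1 := Real.exp_le_one_iff.2 (sub_nonpos.2 hxy)
    have h3 := mul_le_mul_of_nonneg_left (hv x y) (Real.exp_pos (-J x)).le
    nlinarith [mul_nonneg (sub_nonneg.2 h1) (sub_nonneg.2 h2)]
  have hpair' : ∀ x y,
      Real.exp (v y - v x) * Real.exp (-J x) + Real.exp (v x - v y) * Real.exp (-J y) ≤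
        Real.exp (-J x) * (1 + L * max (v y - v x) 0 ^ 2) +
          Real.exp (-J y) * (1 + L * max (v x - v y) 0 ^ 2) := by
    intro x y
    rcases le_total (v x) (v y) with h | h
    · exact hpair x y h
    · linarith [hpair y x h]
  have hprod : (∑ x, μ x * Real.exp (-v x - J x)) * ∑ y, μ y * Real.exp (v y) =
      ∑ x, ∑ y, μ x * μ y * (Real.exp (v y - v x) * Real.exp (-J x)) := by
    rw [sum_mul_sum]
    refine sum_congr rfl fun x _ => sum_congr rfl fun y _ => ?_
    rw [sub_eq_add_neg, sub_eq_add_neg, Real.exp_add, Real.exp_add]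
    ring
  have hbound : ∑ x, ∑ y, μ x * μ y * (Real.exp (-J x) * (1 + L * max (v y - v x) 0 ^ 2)) =
      ∑ x, μ x * (Real.exp (-J x) * (1 + J x)) := by
    refine sum_congr rfl fun x _ => ?_
    have : Real.exp (-J x) * (1 + J x) =
        Real.exp (-J x) * (∑ y, μ y + L * ∑ y, μ y * max (v y - v x) 0 ^ 2) := by
      rw [hsum]
    rw [this, mul_add, mul_sum, mul_sum, mul_sum, ← sum_add_distrib, mul_sum]
    exact sum_congr rfl fun y _ => by ring
  have hfinal : ∑ x, μ x * (Real.exp (-J x) * (1 + J x)) ≤ 1 := by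
    refine (sum_le_sum fun x _ => mul_le_of_le_one_right (hμ x) ?_).trans_eq hsum
    calc Real.exp (-J x) * (1 + J x) ≤ Real.exp (-J x) * Real.exp (J x) := by
          gcongr
          linarith [Real.add_one_le_exp (J x)]
      _ = 1 := by rw [← Real.exp_add, neg_add_cancel, Real.exp_zero]
  have hsymm : ∀ K : Ω → Ω → ℝ,
      2 * ∑ x, ∑ y, μ x * μ y * K x y = ∑ x, ∑ y, μ x * μ y * (K x y + K y x) := by
    intro K
    have : ∑ x, ∑ y, μ x * μ y * K y x = ∑ x, ∑ y, μ x * μ y * K x y := by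
      rw [sum_comm]
      exact sum_congr rfl fun x _ => sum_congr rfl fun y _ => by ring
    simp only [mul_add, sum_add_distrib, this]
    ring
  have hle := sum_le_sum fun x (_ : x ∈ univ) => sum_le_sum fun y (_ : y ∈ univ) =>
    mul_le_mul_of_nonneg_left (hpair' x y) (mul_nonneg (hμ x) (hμ y))
  rw [← hsymm fun x y => Real.exp (v y - v x) * Real.exp (-J x),
    ← hsymm fun x y => Real.exp (-J x) * (1 + L * max (v y - v x) 0 ^ 2), hbound] at hle
  rw [hprod]
  linarith

/-- The one-coordinate transport kernel: for a potential `w` there is a Markov kernel `p` and a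
cost `C` dominating the linear cost of `p` against every `u : Ω → [0, 1 / L]`, up to `L ∫ u²`,
for which the infimum-convolution inequality holds. -/
lemma exists_kernel_s13 {Ω : Type*} [Fintype Ω] [DecidableEq Ω] [Nonempty Ω] {μ : Ω → ℝ}
    (hμ : ∀ ω, 0 ≤ μ ω) (hsum : ∑ ω, μ ω = 1) {L : ℝ} (hL : 0 < L)
    (hcosh : ∀ b, |b| ≤ 1 / L → Real.exp b + Real.exp (-b) - 2 ≤ L * b ^ 2) (w : Ω → ℝ) :
    ∃ (p : Ω → Ω → ℝ) (C : Ω → ℝ), (∀ x y, 0 ≤ p x y) ∧ (∀ x, ∑ y, p x y = 1) ∧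
      (∀ x (u : Ω → ℝ), (∀ y, 0 ≤ u y) → (∀ y, u y ≤ 1 / L) →
        ∑ y, p x y * (if y = x then 0 else u y) ≤ C x + L * ∑ y, μ y * u y ^ 2) ∧
      (∑ x, μ x * Real.exp (C x - ∑ y, p x y * w y)) * ∑ y, μ y * Real.exp (w y) ≤ 1 := by
  obtain ⟨t, ht⟩ := Finite.exists_max w
  set mass : ℝ → ℝ := fun s => ∑ y, μ y * (2 * L * max (w y - s) 0) with hmass
  have hcont : Continuous mass := by fun_prop
  have hanti : ∀ s s', s ≤ s' → mass s' ≤ mass s := by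
    intro s s' h
    refine sum_le_sum fun y _ => ?_
    gcongr
    exact hμ y
  have hwt : mass (w t) = 0 :=
    sum_eq_zero fun y _ => by rw [max_eq_right (sub_nonpos.2 (ht y))]; ring
  have hLinv : 0 < 1 / L := by positivity
  obtain ⟨η, hη1, hη2, hη3, hη4⟩ : ∃ η, w t - 1 / L ≤ η ∧ η ≤ w t ∧ mass η ≤ 1 ∧
      (1 - mass η) * (η - w t + 1 / L) = 0 := by
    rcases le_total (mass (w t - 1 / L)) 1 with h | h
    · exact ⟨w t - 1 / L, le_rfl, by linarith, h, by ring⟩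
    · obtain ⟨η, hη, hη'⟩ := intermediate_value_Icc' (show w t - 1 / L ≤ w t by linarith)
        hcont.continuousOn (show (1 : ℝ) ∈ Set.Icc (mass (w t)) (mass (w t - 1 / L)) from
          ⟨by rw [hwt]; exact zero_le_one, h⟩)
      exact ⟨η, hη.1, hη.2, hη'.le, by rw [hη']; ring⟩
  set e : Ω → ℝ := fun x => max (w x) η with he
  set q : Ω → Ω → ℝ := fun x y => μ y * (2 * L * max (w y - e x) 0) with hq
  set r : Ω → ℝ := fun x => 1 - mass (e x) with hr
  set z : Ω → Ω := fun x => if η ≤ w x then x else t with hz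
  have hq0 : ∀ x y, 0 ≤ q x y := fun x y =>
    mul_nonneg (hμ y) (mul_nonneg (by positivity) (le_max_right _ _))
  have hr0 : ∀ x, 0 ≤ r x := fun x =>
    sub_nonneg.2 ((hanti _ _ (le_max_right _ _)).trans hη3)
  have hsplit : ∀ x (g : Ω → ℝ), ∑ y, (q x y + if y = z x then r x else 0) * g y =
      ∑ y, q x y * g y + r x * g (z x) := by
    intro x g
    simp [add_mul, sum_add_distrib]
  refine ⟨fun x y => q x y + if y = z x then r x else 0,
    fun x => L * ∑ y, μ y * max (w y - e x) 0 ^ 2 + if η ≤ w x then 0 else r x / L,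
    ?_, ?_, ?_, ?_⟩
  · intro x y
    have := hq0 x y
    have := hr0 x
    dsimp only
    split_ifs <;> linarith
  · intro x
    have := hsplit x fun _ => 1
    simp only [mul_one] at this
    rw [this]
    simp [hr, hq, hmass]
  · intro x u hu0 hu1
    rw [hsplit]
    have h1 : ∑ y, q x y * (if y = x then 0 else u y) ≤
        L * ∑ y, μ y * max (w y - e x) 0 ^ 2 + L * ∑ y, μ y * u y ^ 2 := by
      rw [mul_sum, mul_sum, ← sum_add_distrib]
      refine sum_le_sum fun y _ => ?_
      have h2 : q x y * (if y = x then 0 else u y) ≤ q x y * u y := by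
        refine mul_le_mul_of_nonneg_left ?_ (hq0 x y)
        split_ifs
        exacts [hu0 y, le_rfl]
      refine h2.trans ?_
      have h3 := mul_nonneg (mul_nonneg hL.le (hμ y)) (sq_nonneg (max (w y - e x) 0 - u y))
      simp only [hq]
      nlinarith
    have h4 : r x * (if z x = x then 0 else u (z x)) ≤ if η ≤ w x then 0 else r x / L := by
      by_cases h : η ≤ w x
      · simp [hz, h]
      · rw [if_neg h, div_eq_mul_one_div]
        refine mul_le_mul_of_nonneg_left ?_ (hr0 x)
        split_ifs
        exacts [hLinv.le, hu1 _]
    linarith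
  · have hexp : ∀ x, (L * ∑ y, μ y * max (w y - e x) 0 ^ 2 + if η ≤ w x then 0 else r x / L) -
        ∑ y, (q x y + if y = z x then r x else 0) * w y =
        -e x - L * ∑ y, μ y * max (e y - e x) 0 ^ 2 := by
      intro x
      have hmax : ∀ y, max (e y - e x) 0 = max (w y - e x) 0 := by
        intro y
        have : η ≤ e x := le_max_right _ _
        simp only [he] at this ⊢
        grind
      have hqw : ∑ y, q x y * w y =
          2 * (L * ∑ y, μ y * max (w y - e x) 0 ^ 2) + (1 - r x) * e x := by
        have : 1 - r x = ∑ y, q x y := by simp [hr, hq, hmass]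
        rw [this, sum_mul, mul_sum, mul_sum, ← sum_add_distrib]
        refine sum_congr rfl fun y _ => ?_
        simp only [hq]
        rcases max_cases (w y - e x) 0 with ⟨h, -⟩ | ⟨h, -⟩ <;> rw [h] <;> ring
      simp only [hmax]
      rw [hsplit, hqw]
      by_cases h : η ≤ w x
      · have hex : e x = w x := max_eq_left h
        simp only [hz, h, if_true, hex]
        ring
      · have hex : e x = η := max_eq_right (not_le.1 h).le
        have hrx : r x * (η - w t + 1 / L) = 0 := by simpa only [hr, hex] using hη4
        simp only [hz, h, if_false, hex]
        linear_combination hrx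
    simp only [hexp]
    have hosc : ∀ x y, |e y - e x| ≤ 1 / L := by
      intro x y
      have h1 : ∀ x, e x ≤ w t := fun x => max_le (ht x) hη2
      have h2 : ∀ x, η ≤ e x := fun x => le_max_right _ _
      rw [abs_le]
      constructor <;> linarith [h1 x, h1 y, h2 x, h2 y]
    refine le_trans (mul_le_mul_of_nonneg_left (sum_le_sum fun y _ =>
      mul_le_mul_of_nonneg_left (Real.exp_le_exp.2 (le_max_left (w y) η)) (hμ y))
        (sum_nonneg fun x _ => mul_nonneg (hμ x) (Real.exp_pos _).le))
      (sum_exp_neg_sub_mul_sum_exp_le_one hμ hsum hL.le e fun x y => ?_)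
    have := hcosh _ (hosc x y)
    rwa [neg_sub] at this

lemma sum_prod_pi_succ {Ω : Type*} [Fintype Ω] (μ : Ω → ℝ) (n : ℕ)
    (f : (Fin (n + 1) → Ω) → ℝ) :
    ∑ x, (∏ i, μ (x i)) * f x =
      ∑ ω, μ ω * ∑ x : Fin n → Ω, (∏ i, μ (x i)) * f (Fin.cons ω x) := by
  rw [← (Fin.consEquiv fun _ => Ω).sum_comp, Fintype.sum_prod_type]
  refine sum_congr rfl fun ω _ => ?_
  rw [mul_sum]
  refine sum_congr rfl fun x _ => ?_
  simp [Fin.consEquiv, Fin.prod_univ_succ, mul_assoc]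

/-- Tensorized infimum-convolution inequality for product measures. -/
lemma sum_exp_mul_sum_exp_le_one {Ω : Type*} [Fintype Ω] [DecidableEq Ω] [Nonempty Ω]
    {μ : Ω → ℝ} (hμ : ∀ ω, 0 < μ ω) (hsum : ∑ ω, μ ω = 1) {L : ℝ} (hL : 0 < L)
    (hcosh : ∀ b, |b| ≤ 1 / L → Real.exp b + Real.exp (-b) - 2 ≤ L * b ^ 2) (n : ℕ)
    (G H : (Fin n → Ω) → ℝ)
    (hGH : ∀ x, ∃ u : Fin n → Ω → ℝ, (∀ i ω, 0 ≤ u i ω) ∧ (∀ i ω, u i ω ≤ 1 / L) ∧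
      ∀ y, G x + H y ≤ ∑ i, ((if y i = x i then 0 else u i (y i)) -
        L * ∑ ω, μ ω * u i ω ^ 2)) :
    (∑ x, (∏ i, μ (x i)) * Real.exp (G x)) * ∑ y, (∏ i, μ (y i)) * Real.exp (H y) ≤ 1 := by
  induction n with
  | zero =>
    obtain ⟨u, -, -, h⟩ := hGH default
    have := h default
    simpa [← Real.exp_add] using this
  | succ n ih =>
    choose u hu0 hu1 hu using hGH
    have hpos : ∀ x : Fin n → Ω, 0 < ∏ i, μ (x i) := fun x => prod_pos fun i _ => hμ (x i)
    set S : Ω → ℝ := fun ω => ∑ y : Fin n → Ω, (∏ i, μ (y i)) * Real.exp (H (Fin.cons ω y))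
      with hS
    have hSpos : ∀ ω, 0 < S ω := fun ω =>
      sum_pos (fun y _ => mul_pos (hpos y) (Real.exp_pos _)) univ_nonempty
    obtain ⟨p, C, hp0, hp1, hpC, hfin⟩ :=
      exists_kernel_s13 (fun ω => (hμ ω).le) hsum hL hcosh fun ω => Real.log (S ω)
    simp only [Real.exp_log (hSpos _)] at hfin
    set K : Ω → Ω → (Fin n → Ω) → ℝ := fun a b x => G (Fin.cons a x) -
      (if b = a then 0 else u (Fin.cons a x) 0 b) +
        L * ∑ ω, μ ω * u (Fin.cons a x) 0 ω ^ 2 with hK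
    have hstep : ∀ a b, ∑ x : Fin n → Ω, (∏ i, μ (x i)) *
        Real.exp (K a b x + Real.log (S b)) ≤ 1 := by
      intro a b
      have := ih (K a b) (fun y => H (Fin.cons b y)) fun x =>
        ⟨fun i => u (Fin.cons a x) i.succ, fun i => hu0 _ _, fun i => hu1 _ _, fun y => by
          have := hu (Fin.cons a x) (Fin.cons b y)
          rw [Fin.sum_univ_succ] at this
          simp only [Fin.cons_zero, Fin.cons_succ] at this
          simp only [hK]
          linarith⟩
      simp only [Real.exp_add, Real.exp_log (hSpos b), ← mul_assoc, ← sum_mul]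
      exact this
    have hG : ∀ a (x : Fin n → Ω), Real.exp (G (Fin.cons a x)) ≤
        Real.exp (C a - ∑ b, p a b * Real.log (S b)) *
          ∑ b, p a b * Real.exp (K a b x + Real.log (S b)) := by
      intro a x
      have h1 := convexOn_exp.map_sum_le (t := univ) (w := p a)
        (p := fun b => K a b x + Real.log (S b)) (fun b _ => hp0 a b) (hp1 a)
        (fun b _ => Set.mem_univ _)
      simp only [smul_eq_mul] at h1
      refine le_trans ?_ (mul_le_mul_of_nonneg_left h1 (Real.exp_pos _).le)
      rw [← Real.exp_add]
      refine Real.exp_le_exp.2 ?_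
      have h2 := hpC a (u (Fin.cons a x) 0) (hu0 _ _) (hu1 _ _)
      have h3 : ∑ b, p a b * (K a b x + Real.log (S b)) =
          G (Fin.cons a x) - ∑ b, p a b * (if b = a then 0 else u (Fin.cons a x) 0 b) +
            L * ∑ ω, μ ω * u (Fin.cons a x) 0 ω ^ 2 + ∑ b, p a b * Real.log (S b) := by
        simp only [hK, mul_add, mul_sub, sum_add_distrib, sum_sub_distrib, ← sum_mul, hp1,
          one_mul]
      rw [h3]
      linarith
    have hsumG : ∀ a, ∑ x : Fin n → Ω, (∏ i, μ (x i)) * Real.exp (G (Fin.cons a x)) ≤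
        Real.exp (C a - ∑ b, p a b * Real.log (S b)) := by
      intro a
      calc ∑ x : Fin n → Ω, (∏ i, μ (x i)) * Real.exp (G (Fin.cons a x))
          ≤ ∑ x : Fin n → Ω, (∏ i, μ (x i)) *
              (Real.exp (C a - ∑ b, p a b * Real.log (S b)) *
                ∑ b, p a b * Real.exp (K a b x + Real.log (S b))) :=
            sum_le_sum fun x _ => mul_le_mul_of_nonneg_left (hG a x) (hpos x).le
        _ = Real.exp (C a - ∑ b, p a b * Real.log (S b)) * ∑ b, p a b *
              ∑ x : Fin n → Ω, (∏ i, μ (x i)) * Real.exp (K a b x + Real.log (S b)) := by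
            simp only [mul_sum]
            rw [sum_comm]
            exact sum_congr rfl fun b _ => sum_congr rfl fun x _ => by ring
        _ ≤ Real.exp (C a - ∑ b, p a b * Real.log (S b)) * ∑ b, p a b * 1 := by
            gcongr with b
            · exact hp0 a b
            · exact hstep a b
        _ = _ := by simp [hp1]
    rw [sum_prod_pi_succ, sum_prod_pi_succ]
    refine le_trans (mul_le_mul_of_nonneg_right (sum_le_sum fun a _ =>
      mul_le_mul_of_nonneg_left (hsumG a) (hμ a).le) ?_) hfin
    exact sum_nonneg fun ω _ => mul_nonneg (hμ ω).le (hSpos ω).le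

lemma exp_add_exp_neg_sub_two_le {b : ℝ} (hb : |b| ≤ 1 / 1.12) :
    Real.exp b + Real.exp (-b) - 2 ≤ 1.12 * b ^ 2 := by
  have hb1 : |b| ≤ 1 := hb.trans (by norm_num)
  have h1 := (abs_le.1 (Real.exp_bound hb1 (n := 5) (by norm_num))).2
  have h2 := (abs_le.1 (Real.exp_bound (x := -b) (by rwa [abs_neg]) (n := 5) (by norm_num))).2
  simp only [sum_range_succ, sum_range_zero, abs_neg] at h1 h2
  norm_num [Nat.factorial] at h1 h2
  have h3 : |b| ^ 2 = b ^ 2 := sq_abs b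
  have h4 : b ^ 2 ≤ 0.8 := by
    rw [← h3]
    have := pow_le_pow_left₀ (abs_nonneg b) hb 2
    norm_num at this ⊢
    linarith
  have h5 : |b| ^ 5 ≤ 0.8 * b ^ 2 := by
    have : |b| ^ 5 = b ^ 2 * b ^ 2 * |b| := by rw [← h3]; ring
    rw [this]
    nlinarith [mul_nonneg (mul_nonneg (sq_nonneg b) (sq_nonneg b)) (sub_nonneg.2 hb1),
      mul_nonneg (sq_nonneg b) (sub_nonneg.2 h4)]
  nlinarith [mul_nonneg (sq_nonneg b) (sub_nonneg.2 h4), sq_nonneg b]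

/-- Exponential Chebyshev inequality above a median, from a bound on the product of the
exponential moments of orders `l` and `-l`. -/
lemma sum_filter_le_two_mul_exp {α : Type*} [Fintype α] {m : α → ℝ} (hm : ∀ x, 0 ≤ m x)
    {Z : α → ℝ} {l M t V : ℝ} (hl : 0 ≤ l)
    (hprod : (∑ x, m x * Real.exp (l * Z x)) * ∑ x, m x * Real.exp (-(l * Z x)) ≤ Real.exp V)
    (hM : (1 : ℝ) / 2 ≤ ∑ x ∈ univ.filter (fun x => Z x ≤ M), m x) :
    ∑ x ∈ univ.filter (fun x => M + t ≤ Z x), m x ≤ 2 * Real.exp (V - l * t) := by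
  have hlow : 1 / 2 * Real.exp (-(l * M)) ≤ ∑ x, m x * Real.exp (-(l * Z x)) :=
    calc 1 / 2 * Real.exp (-(l * M))
        ≤ (∑ x ∈ univ.filter (fun x => Z x ≤ M), m x) * Real.exp (-(l * M)) := by gcongr
      _ ≤ ∑ x ∈ univ.filter (fun x => Z x ≤ M), m x * Real.exp (-(l * Z x)) := by
        rw [sum_mul]
        refine sum_le_sum fun x hx => mul_le_mul_of_nonneg_left (Real.exp_le_exp.2 ?_) (hm x)
        exact neg_le_neg (mul_le_mul_of_nonneg_left (mem_filter.1 hx).2 hl)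
      _ ≤ _ := sum_le_sum_of_subset_of_nonneg (filter_subset _ _)
        fun x _ _ => mul_nonneg (hm x) (Real.exp_pos _).le
  have hhigh : (∑ x ∈ univ.filter (fun x => M + t ≤ Z x), m x) * Real.exp (l * (M + t)) ≤
      ∑ x, m x * Real.exp (l * Z x) :=
    calc _ ≤ ∑ x ∈ univ.filter (fun x => M + t ≤ Z x), m x * Real.exp (l * Z x) := by
          rw [sum_mul]
          refine sum_le_sum fun x hx => mul_le_mul_of_nonneg_left (Real.exp_le_exp.2 ?_) (hm x)
          exact mul_le_mul_of_nonneg_left (mem_filter.1 hx).2 hl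
      _ ≤ _ := sum_le_sum_of_subset_of_nonneg (filter_subset _ _)
        fun x _ _ => mul_nonneg (hm x) (Real.exp_pos _).le
  have hmul := (mul_le_mul hhigh hlow (by positivity)
    (sum_nonneg fun x _ => mul_nonneg (hm x) (Real.exp_pos _).le)).trans hprod
  have h1 : Real.exp (l * (M + t)) * Real.exp (-(l * M)) = Real.exp (l * t) := by
    rw [← Real.exp_add]; ring_nf
  rw [Real.exp_sub, ← mul_div_assoc, le_div_iff₀ (Real.exp_pos _), ← h1]
  linarith

/-- For L = 1.12 and M a median of Z, for every u > 0,
P(Z ≥ M + 2 max(Lu, σ√(Lu))) ≤ 2 e^{−u}. -/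
theorem concentration_above_median {Ω : Type*} [Fintype Ω] [DecidableEq Ω] [Nonempty Ω]
    (μ : Ω → ℝ) (hμpos : ∀ ω, 0 < μ ω) (hμsum : ∑ ω, μ ω = 1)
    (n : ℕ) (F : Finset (Ω → ℝ)) (hF : F.Nonempty)
    (hrange : ∀ f ∈ F, ∀ ω, f ω ∈ Set.Icc (0 : ℝ) 1)
    (Z : (Fin n → Ω) → ℝ)
    (hZ : ∀ x, Z x = F.sup' hF (fun f => ∑ i : Fin n, ((∑ ω, f ω * μ ω) - f (x i))))
    (σ : ℝ) (hσ : σ = Real.sqrt (n * F.sup' hF (fun f => ∑ ω, f ω ^ 2 * μ ω)))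
    (L : ℝ) (hL : L = 1.12)
    (M : ℝ)
    (hM1 : (1 : ℝ) / 2 ≤ ∑ x ∈ univ.filter (fun x : Fin n → Ω => Z x ≤ M), ∏ i, μ (x i))
    (hM2 : (1 : ℝ) / 2 ≤ ∑ x ∈ univ.filter (fun x : Fin n → Ω => M ≤ Z x), ∏ i, μ (x i))
    (u : ℝ) (hu : 0 < u) :
    ∑ x ∈ univ.filter
        (fun x : Fin n → Ω => M + 2 * max (L * u) (σ * Real.sqrt (L * u)) ≤ Z x),
      ∏ i, μ (x i) ≤ 2 * Real.exp (-u) := by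
  have hL0 : 0 < L := by rw [hL]; norm_num
  have hcosh : ∀ b, |b| ≤ 1 / L → Real.exp b + Real.exp (-b) - 2 ≤ L * b ^ 2 := by
    rw [hL]; exact fun b => exp_add_exp_neg_sub_two_le
  have hvar : ∀ f ∈ F, n * ∑ ω, μ ω * f ω ^ 2 ≤ σ ^ 2 := by
    intro f hf
    have hle : ∑ ω, f ω ^ 2 * μ ω ≤ F.sup' hF (fun f => ∑ ω, f ω ^ 2 * μ ω) :=
      le_sup' (fun f : Ω → ℝ => ∑ ω, f ω ^ 2 * μ ω) hf
    have h0 : 0 ≤ ∑ ω, f ω ^ 2 * μ ω :=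
      sum_nonneg fun ω _ => mul_nonneg (sq_nonneg _) (hμpos ω).le
    rw [hσ, Real.sq_sqrt (mul_nonneg n.cast_nonneg (h0.trans hle))]
    simp only [mul_comm (μ _)]
    exact mul_le_mul_of_nonneg_left hle n.cast_nonneg
  have hσ0 : 0 ≤ σ := hσ ▸ Real.sqrt_nonneg _
  have hexp : ∀ l, 0 ≤ l → l ≤ 1 / L →
      (∑ x : Fin n → Ω, (∏ i, μ (x i)) * Real.exp (l * Z x)) *
        ∑ x : Fin n → Ω, (∏ i, μ (x i)) * Real.exp (-(l * Z x)) ≤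
          Real.exp (L * l ^ 2 * σ ^ 2) := by
    intro l hl0 hl1
    have key := sum_exp_mul_sum_exp_le_one hμpos hμsum hL0 hcosh n
      (fun x => l * Z x - L * l ^ 2 * σ ^ 2) (fun x => -(l * Z x)) fun x => by
        obtain ⟨f, hf, hfx⟩ := exists_mem_eq_sup' hF
          (fun f => ∑ i : Fin n, ((∑ ω, f ω * μ ω) - f (x i)))
        refine ⟨fun _ ω => l * f ω, fun _ ω => mul_nonneg hl0 (hrange f hf ω).1, fun _ ω =>
          (mul_le_of_le_one_right hl0 (hrange f hf ω).2).trans hl1, fun y => ?_⟩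
        have hy : ∑ i : Fin n, ((∑ ω, f ω * μ ω) - f (y i)) ≤ Z y := by
          rw [hZ y]
          exact le_sup' (fun f : Ω → ℝ => ∑ i : Fin n, ((∑ ω, f ω * μ ω) - f (y i))) hf
        have hdiff : Z x - Z y ≤ ∑ i, (f (y i) - f (x i)) := by
          rw [hZ x, hfx]
          refine (sub_le_sub_left hy _).trans_eq ?_
          rw [← sum_sub_distrib]
          exact sum_congr rfl fun i _ => by ring
        have hmove : l * ∑ i, (f (y i) - f (x i)) ≤
            ∑ i, if y i = x i then 0 else l * f (y i) := by
          rw [mul_sum]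
          refine sum_le_sum fun i _ => ?_
          split_ifs with h
          · simp [h]
          · exact mul_le_mul_of_nonneg_left (by linarith [(hrange f hf (x i)).1]) hl0
        have hcost : ∑ _i : Fin n, L * ∑ ω, μ ω * (l * f ω) ^ 2 =
            L * l ^ 2 * (n * ∑ ω, μ ω * f ω ^ 2) := by
          have : ∑ ω, μ ω * (l * f ω) ^ 2 = l ^ 2 * ∑ ω, μ ω * f ω ^ 2 := by
            rw [mul_sum]
            exact sum_congr rfl fun ω _ => by ring
          rw [sum_const, card_univ, Fintype.card_fin, nsmul_eq_mul, this]
          ring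
        rw [sum_sub_distrib, hcost]
        have h1 := mul_le_mul_of_nonneg_left hdiff hl0
        have h2 := mul_le_mul_of_nonneg_left (hvar f hf)
          (mul_nonneg hL0.le (sq_nonneg l))
        linarith
    simp only [Real.exp_sub, mul_div_assoc', ← sum_div] at key
    rwa [div_mul_eq_mul_div, div_le_one (Real.exp_pos _)] at key
  have hm : ∀ x : Fin n → Ω, 0 ≤ ∏ i, μ (x i) := fun x => prod_nonneg fun i _ => (hμpos _).le
  have hLu : 0 < L * u := mul_pos hL0 hu
  have hs := Real.sqrt_pos.2 hLu
  have hss := Real.sq_sqrt hLu.le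
  obtain ⟨l, hl0, hl1, hl⟩ : ∃ l, 0 ≤ l ∧ l ≤ 1 / L ∧
      L * l ^ 2 * σ ^ 2 - l * (2 * max (L * u) (σ * Real.sqrt (L * u))) ≤ -u := by
    rcases le_total σ (Real.sqrt (L * u)) with h | h
    · refine ⟨1 / L, by positivity, le_rfl, ?_⟩
      have h1 : σ ^ 2 ≤ L * u := hss ▸ pow_le_pow_left₀ hσ0 h 2
      have h2 : 1 / L * (L * u) ≤ 1 / L * max (L * u) (σ * Real.sqrt (L * u)) :=
        mul_le_mul_of_nonneg_left (le_max_left _ _) (by positivity)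
      have h3 : L * (1 / L) ^ 2 * σ ^ 2 ≤ L * (1 / L) ^ 2 * (L * u) :=
        mul_le_mul_of_nonneg_left h1 (by positivity)
      have h4 : L * (1 / L) ^ 2 * (L * u) = u := by field_simp
      have h5 : 1 / L * (L * u) = u := by field_simp
      linarith
    · have hσpos : 0 < σ := hs.trans_le h
      refine ⟨Real.sqrt (L * u) / (L * σ), by positivity, ?_, ?_⟩
      · rw [div_le_div_iff₀ (by positivity) hL0]
        nlinarith
      · have h2 : Real.sqrt (L * u) / (L * σ) * (σ * Real.sqrt (L * u)) ≤
            Real.sqrt (L * u) / (L * σ) * max (L * u) (σ * Real.sqrt (L * u)) :=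
          mul_le_mul_of_nonneg_left (le_max_right _ _) (by positivity)
        have h3 : Real.sqrt (L * u) / (L * σ) * (σ * Real.sqrt (L * u)) = u := by
          have : Real.sqrt (L * u) / (L * σ) * (σ * Real.sqrt (L * u)) =
              Real.sqrt (L * u) ^ 2 / L := by field_simp
          rw [this, hss]
          field_simp
        have h4 : L * (Real.sqrt (L * u) / (L * σ)) ^ 2 * σ ^ 2 = u := by
          have : L * (Real.sqrt (L * u) / (L * σ)) ^ 2 * σ ^ 2 =
              Real.sqrt (L * u) ^ 2 / L := by field_simp
          rw [this, hss]
          field_simp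
        linarith
  refine (sum_filter_le_two_mul_exp hm hl0 (hexp l hl0 hl1) hM1).trans ?_
  gcongr
end
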